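/- arXiv:1202.5557 — 4 statements merged into one kernel-verified Lean document; each statement's English description precedes it below -/
import Mathlib

section
/- Let k be a field equipped with a non-Archimedean absolute value, with valuation ring 𝔬 and residue field 𝔽, and let φ ∈ k(z) be a rational function of degree at least 2 that has good reduction. Then every element s ∈ PGL₂(k) satisfying s ∘ φ ∘ s⁻¹ = φ has good reduction, and reduction of matrix entries modulo the maximal ideal induces a group homomorphism red : Aut_φ(k) → Aut_φ(𝔽). -/
open MvPolynomial

noncomputable section

/-- `PGL₂(R)`: the projective general linear group of 2×2 matrices. -/
abbrev PGL2 (R : Type*) [CommRing R] : Type _ :=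
  GL (Fin 2) R ⧸ Subgroup.center (GL (Fin 2) R)

/-- The class of an invertible matrix in `PGL₂`. -/
def PGL2.mk {R : Type*} [CommRing R] (M : GL (Fin 2) R) : PGL2 R :=
  QuotientGroup.mk M

/-- The pair of linear forms attached to a 2×2 matrix. -/
def linForms {R : Type*} [CommRing R] (M : Matrix (Fin 2) (Fin 2) R) :
    Fin 2 → MvPolynomial (Fin 2) R :=
  fun i => C (M i 0) * X 0 + C (M i 1) * X 1

/-- The matrix `M` conjugates the pair of binary forms `Φ` to `Ψ`,
i.e. `S ∘ Φ = λ · (Ψ ∘ S)` for some scalar `λ`, where `S` is the pair of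
linear forms of `M`.  This is the homogeneous form of `s ∘ φ ∘ s⁻¹ = ψ`. -/
def MatConj {R : Type*} [CommRing R] (Φ Ψ : Fin 2 → MvPolynomial (Fin 2) R)
    (M : GL (Fin 2) R) : Prop :=
  ∃ c : Rˣ, ∀ i,
    bind₁ Φ (linForms (M : Matrix (Fin 2) (Fin 2) R) i) =
      C (c : R) * bind₁ (linForms (M : Matrix (Fin 2) (Fin 2) R)) (Ψ i)

/-- `Conj_{φ,ψ}(R)`: the set of elements of `PGL₂(R)` conjugating `φ` to `ψ`. -/
def ConjSet {R : Type*} [CommRing R] (Φ Ψ : Fin 2 → MvPolynomial (Fin 2) R) :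
    Set (PGL2 R) :=
  {s | ∃ M : GL (Fin 2) R, PGL2.mk M = s ∧ MatConj Φ Ψ M}

/-- `Aut_φ(R)`: the automorphism group of `φ` inside `PGL₂(R)`. -/
def AutSet {R : Type*} [CommRing R] (Φ : Fin 2 → MvPolynomial (Fin 2) R) :
    Set (PGL2 R) :=
  ConjSet Φ Φ

/-- The valuation ring of a non-Archimedean absolute value. -/
def ValSubring {k : Type*} [Field k] (v : AbsoluteValue k ℝ)
    (hv : IsNonarchimedean v) : Subring k where
  carrier := {x | v x ≤ 1}
  one_mem' := by simp
  mul_mem' := by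
    intro a b ha hb
    have h := v.nonneg a
    have h' := v.nonneg b
    have ha' : v a ≤ 1 := ha
    have hb' : v b ≤ 1 := hb
    show v (a * b) ≤ 1
    rw [v.map_mul]
    nlinarith
  zero_mem' := by simp
  add_mem' := by
    intro a b ha hb
    exact le_trans (hv a b) (max_le ha hb)
  neg_mem' := by
    intro a ha
    show v (-a) ≤ 1
    rwa [v.map_neg]

/-- An element of `PGL₂(k)` has good reduction: it is represented by a matrix
with entries in the valuation ring whose determinant is a unit there. -/
def MatGoodRed {k : Type*} [Field k] (v : AbsoluteValue k ℝ)
    (hv : IsNonarchimedean v) (s : PGL2 k) : Prop :=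
  ∃ (M : GL (Fin 2) k) (N : Matrix (Fin 2) (Fin 2) (ValSubring v hv)),
    PGL2.mk M = s ∧
    (∀ i j, (N i j : k) = (M : Matrix (Fin 2) (Fin 2) k) i j) ∧
    IsUnit N.det

theorem aux_hom_aeval {σ R S : Type*} [CommRing R] [CommRing S] [Algebra R S]
    {F : MvPolynomial σ R} {d : ℕ} (hF : F.IsHomogeneous d) (r : S) (x : σ → S) :
    aeval (fun i => r * x i) F = r ^ d * aeval x F := by
  simp only [aeval_def, eval₂_eq, Finset.mul_sum]
  refine Finset.sum_congr rfl fun m hm => ?_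
  have h := hF (mem_support_iff.mp hm)
  have h2 : ∑ i ∈ m.support, m i = d := by
    rw [← h]
    simp [Finsupp.weight_apply, Finsupp.sum]
  simp only [mul_pow, Finset.prod_mul_distrib, Finset.prod_pow_eq_pow_sum, h2]
  ring

theorem aux_hom_eval {σ R : Type*} [CommRing R]
    {F : MvPolynomial σ R} {d : ℕ} (hF : F.IsHomogeneous d) (r : R) (x : σ → R) :
    eval (fun i => r * x i) F = r ^ d * eval x F := by
  have := aux_hom_aeval (S := R) hF r x
  simpa [coe_aeval_eq_eval] using this

theorem aux_dvd {F : Type*} [Field F] {P : MvPolynomial (Fin 2) F} {d : ℕ}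
    (hP : P.IsHomogeneous d) (u : Fin 2 → F) (hu : u ≠ 0) (h0 : eval u P = 0) :
    C (u 1) * X 0 - C (u 0) * X 1 ∣ P := by
  set l : MvPolynomial (Fin 2) F := C (u 1) * X 0 - C (u 0) * X 1 with hl
  let q := Ideal.Quotient.mkₐ F (Ideal.span {l})
  have hq : ∀ p, q p = 0 ↔ l ∣ p := fun p => by
    rw [← Ideal.mem_span_singleton]
    exact Ideal.Quotient.eq_zero_iff_mem
  have hrel : q (C (u 1)) * q (X 0) = q (C (u 0)) * q (X 1) := by
    have : q l = 0 := (hq l).2 dvd_rfl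
    have h' : q (C (u 1) * X 0 - C (u 0) * X 1) = 0 := this
    rw [map_sub, map_mul, map_mul, sub_eq_zero] at h'
    exact h'
  have key : ∀ i0 : Fin 2, u i0 ≠ 0 → l ∣ P := by
    intro i0 hi0
    have e : ∀ i, q (C (u i0)) * q (X i) = q (X i0) * q (C (u i)) := by
      intro i
      fin_cases i0 <;> fin_cases i <;> simp only [Fin.zero_eta, Fin.mk_one]
      · ring
      · rw [← hrel]; ring
      · rw [hrel]; ring
      · ring
    have h1 : aeval (fun i => q (C (u i0)) * q (X i)) P = q (C (u i0)) ^ d * q P := by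
      rw [aux_hom_aeval hP]
      congr 1
      have := (MvPolynomial.comp_aeval_apply (X : Fin 2 → MvPolynomial (Fin 2) F) q P).symm
      simpa using this
    have h2 : aeval (fun i => q (X i0) * q (C (u i))) P = 0 := by
      rw [aux_hom_aeval hP]
      have : aeval (fun i => q (C (u i))) P
          = algebraMap F _ (eval u P) := by
        have h3 := MvPolynomial.aeval_algebraMap_apply
          (A := F) (MvPolynomial (Fin 2) F ⧸ Ideal.span {l}) u P
        rw [aeval_eq_eval] at h3
        exact h3
      rw [this, h0]
      simp
    simp only [e] at h1
    rw [h2, ← map_pow, ← map_mul] at h1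
    have h4 := (hq _).1 h1.symm
    have hun : IsUnit ((C (u i0) : MvPolynomial (Fin 2) F) ^ d) :=
      ((isUnit_iff_ne_zero.2 hi0).map C).pow d
    exact (hun.dvd_mul_left).1 h4
  obtain ⟨i0, hi0⟩ := Function.ne_iff.1 hu
  exact key i0 hi0

theorem aux_nozero {F : Type*} [Field F] {P : Fin 2 → MvPolynomial (Fin 2) F} {d : ℕ}
    (hP : ∀ i, (P i).IsHomogeneous d) (hrel : IsRelPrime (P 0) (P 1))
    (u : Fin 2 → F) (h0 : ∀ i, eval u (P i) = 0) : u = 0 := by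
  by_contra hu
  have h := hrel (aux_dvd (hP 0) u hu (h0 0)) (aux_dvd (hP 1) u hu (h0 1))
  have h2 := h.map (eval u)
  apply h2.ne_zero
  simp
  ring

theorem aux_bind_lin {R : Type*} [CommRing R] (A : Fin 2 → MvPolynomial (Fin 2) R)
    (N : Matrix (Fin 2) (Fin 2) R) (i : Fin 2) :
    bind₁ A (linForms N i) = C (N i 0) * A 0 + C (N i 1) * A 1 := by
  simp [linForms]

theorem aux_eval_bind {R : Type*} [CommRing R] (P : MvPolynomial (Fin 2) R)
    (N : Matrix (Fin 2) (Fin 2) R) (u : Fin 2 → R) :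
    eval u (bind₁ (linForms N) P) = eval (fun i => N i 0 * u 0 + N i 1 * u 1) P := by
  have h := aeval_bind₁ (S := R) u (linForms N) P
  have e : (fun i => aeval (S₁ := R) u (linForms N i))
      = fun i => N i 0 * u 0 + N i 1 * u 1 := by
    funext i
    simp [linForms]
  rw [e, aeval_eq_eval, aeval_eq_eval] at h
  exact h

theorem aux_map_lin {R S : Type*} [CommRing R] [CommRing S] (f : R →+* S)
    (N : Matrix (Fin 2) (Fin 2) R) (i : Fin 2) :
    MvPolynomial.map f (linForms N i) = linForms (N.map f) i := by
  simp [linForms]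

theorem aux_eval_map {R S : Type*} [CommRing R] [CommRing S] (f : R →+* S)
    (P : MvPolynomial (Fin 2) R) (u : Fin 2 → R) :
    eval (fun i => f (u i)) (MvPolynomial.map f P) = f (eval u P) := by
  rw [eval_map, eval₂_comp]
  rfl

theorem aux_core2 {O F : Type*} [CommRing O] [Field F] (p : O →+* F)
    {A : Fin 2 → MvPolynomial (Fin 2) O} {d : ℕ} (hA : ∀ i, (A i).IsHomogeneous d)
    (hrel : IsRelPrime (MvPolynomial.map p (A 0)) (MvPolynomial.map p (A 1)))
    (N : Matrix (Fin 2) (Fin 2) O) (i0 j0 : Fin 2) (hN : p (N i0 j0) ≠ 0)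
    (mu : O) (hmu : p mu = 0)
    (heq : ∀ i, C mu * bind₁ A (linForms N i) = bind₁ (linForms N) (A i)) : False := by
  have h := aux_nozero (P := fun i => MvPolynomial.map p (A i))
    (fun i => (hA i).map p) hrel (fun i => p (N i j0)) (by
      intro i
      rw [aux_eval_map p (A i) (fun i => N i j0)]
      have h1 := congrArg (eval (Pi.single j0 1)) (heq i)
      rw [aux_eval_bind] at h1
      have h2 : (fun i => N i 0 * (Pi.single j0 1 : Fin 2 → O) 0
          + N i 1 * (Pi.single j0 1 : Fin 2 → O) 1) = fun i => N i j0 := by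
        funext i
        fin_cases j0 <;> simp
      rw [h2] at h1
      rw [← h1]
      simp [hmu])
  exact hN (congrFun h i0)

theorem aux_core1 {O F : Type*} [CommRing O] [IsDomain O] [Field F] (p : O →+* F)
    {A : Fin 2 → MvPolynomial (Fin 2) O} {d : ℕ} (hd : 2 ≤ d)
    (hA : ∀ i, (A i).IsHomogeneous d)
    (hrel : IsRelPrime (MvPolynomial.map p (A 0)) (MvPolynomial.map p (A 1)))
    (N : Matrix (Fin 2) (Fin 2) O) (i0 j0 : Fin 2) (hN : p (N i0 j0) ≠ 0)
    (hdet : N.det ≠ 0) (lam : O)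
    (heq : ∀ i, bind₁ A (linForms N i) = C lam * bind₁ (linForms N) (A i)) :
    p N.det ≠ 0 := by
  intro hp0
  have key : ∀ u : Fin 2 → O, ∀ e : Fin 2 → O,
      (∀ i, N i 0 * u 0 + N i 1 * u 1 = N.det * e i) → (fun i => p (u i)) = 0 := by
    intro u e hu
    refine aux_nozero (P := fun i => MvPolynomial.map p (A i))
      (fun i => (hA i).map p) hrel _ ?_
    have h1 : ∀ i, N i 0 * eval u (A 0) + N i 1 * eval u (A 1)
        = lam * (N.det ^ d * eval e (A i)) := by
      intro i
      have h := congrArg (eval u) (heq i)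
      rw [aux_bind_lin, map_mul, aux_eval_bind] at h
      simp only [hu] at h
      rw [aux_hom_eval (hA i)] at h
      simpa using h
    obtain ⟨m, rfl⟩ : ∃ m, d = m + 2 := ⟨d - 2, by omega⟩
    have ha := h1 0
    have hb := h1 1
    have hD := Matrix.det_fin_two N
    intro i
    rw [aux_eval_map]
    have : eval u (A i) = N.det * (lam * N.det ^ m *
        (if i = 0 then N 1 1 * eval e (A 0) - N 0 1 * eval e (A 1)
          else N 0 0 * eval e (A 1) - N 1 0 * eval e (A 0))) := by
      apply mul_left_cancel₀ hdet
      fin_cases i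
      · simp only [Fin.zero_eta, if_true]
        nth_rewrite 1 [hD]
        linear_combination N 1 1 * ha - N 0 1 * hb
      · simp only [Fin.mk_one, one_ne_zero, if_false]
        nth_rewrite 1 [hD]
        linear_combination N 0 0 * hb - N 1 0 * ha
    rw [this, map_mul, hp0, zero_mul]
  have k0 := key ![N 1 1, - N 1 0] ![1, 0] (by
    intro i
    rw [Matrix.det_fin_two]
    fin_cases i <;> simp <;> ring)
  have k1 := key ![- N 0 1, N 0 0] ![0, 1] (by
    intro i
    rw [Matrix.det_fin_two]
    fin_cases i <;> simp <;> ring)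
  apply hN
  have a0 := congrFun k0 0
  have a1 := congrFun k0 1
  have b0 := congrFun k1 0
  have b1 := congrFun k1 1
  simp at a0 a1 b0 b1
  fin_cases i0 <;> fin_cases j0 <;> simp [a0, a1, b0, b1]

theorem aux_mk_eq {F : Type*} [Field F] (M M' : GL (Fin 2) F) :
    PGL2.mk M = PGL2.mk M' ↔ ∃ a : F, a ≠ 0 ∧ ∀ i j, M'.1 i j = a * M.1 i j := by
  unfold PGL2.mk
  rw [QuotientGroup.eq, Matrix.GeneralLinearGroup.mem_center_iff_val_mem_range_scalar]
  constructor
  · rintro ⟨a, ha⟩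
    have h : M'.1 = M.1 * Matrix.scalar (Fin 2) a := by
      rw [ha, ← Units.val_mul, mul_inv_cancel_left]
    refine ⟨a, ?_, ?_⟩
    · rintro rfl
      have h5 := M'.isUnit
      rw [h] at h5
      simp at h5
    · intro i j
      rw [h]
      simp [mul_comm]
  · rintro ⟨a, ha, h⟩
    refine ⟨a, ?_⟩
    have h2 : M'.1 = M.1 * Matrix.scalar (Fin 2) a := by
      ext i j
      rw [h]
      simp [mul_comm]
    rw [Units.val_mul, h2, ← mul_assoc, ← Units.val_mul]
    simp

theorem aux_conj_scale {k : Type*} [Field k] {d : ℕ} {Φ : Fin 2 → MvPolynomial (Fin 2) k}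
    (hhom : ∀ i, (Φ i).IsHomogeneous d) (c : k) (hc : c ≠ 0) (M : Matrix (Fin 2) (Fin 2) k)
    (lam : k) (hlam : lam ≠ 0)
    (h : ∀ i, bind₁ Φ (linForms M i) = C lam * bind₁ (linForms M) (Φ i))
    (a : k) (ha : a ≠ 0) :
    ∃ mu : k, mu ≠ 0 ∧ ∀ i, bind₁ (fun j => c • Φ j) (linForms (a • M) i)
      = C mu * bind₁ (linForms (a • M)) (c • Φ i) := by
  refine ⟨a * lam * (a ^ d)⁻¹, by positivity, ?_⟩
  intro i
  have e1 : linForms (a • M) = fun i => C a * linForms M i := by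
    funext i
    simp [linForms]
    ring
  have e2 : bind₁ (linForms (a • M)) (c • Φ i) = C c * (C a ^ d * bind₁ (linForms M) (Φ i)) := by
    rw [e1, smul_eq_C_mul, map_mul, bind₁_C_right, ← aeval_eq_bind₁, aux_hom_aeval (hhom i),
      aeval_eq_bind₁]
  rw [e2]
  have h1 := h i
  rw [aux_bind_lin] at h1 ⊢
  simp only [Matrix.smul_apply, smul_eq_mul, smul_eq_C_mul, C_mul]
  have h3 : (C (a ^ d)⁻¹ : MvPolynomial (Fin 2) k) * C a ^ d = 1 := by
    rw [← C_pow, ← C_mul, inv_mul_cancel₀ (pow_ne_zero d ha), C_1]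
  linear_combination C a * C c * h1 - C a * C lam * C c * bind₁ (linForms M) (Φ i) * h3

instance aux_dom {k : Type*} [Field k] (v : AbsoluteValue k ℝ)
    (hv : IsNonarchimedean v) : IsDomain (ValSubring v hv) :=
  inferInstance

theorem aux_unit {k : Type*} [Field k] (v : AbsoluteValue k ℝ)
    (hv : IsNonarchimedean v) (x : ValSubring v hv) : IsUnit x ↔ v (x : k) = 1 := by
  constructor
  · intro h
    obtain ⟨y, hy⟩ := h.exists_right_inv
    have h1 : v (x : k) * v (y : k) = 1 := by
      rw [← v.map_mul]
      have : (x : k) * (y : k) = 1 := congrArg Subtype.val hy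
      rw [this, v.map_one]
    have hx : v (x : k) ≤ 1 := x.2
    have hy : v (y : k) ≤ 1 := y.2
    nlinarith [v.nonneg (x : k), v.nonneg (y : k)]
  · intro h
    have hx : (x : k) ≠ 0 := by
      intro h0
      simp [h0] at h
    refine IsUnit.of_mul_eq_one ⟨(x : k)⁻¹, ?_⟩ ?_
    · show v _ ≤ 1
      rw [map_inv₀, h, inv_one]
    · exact Subtype.ext (mul_inv_cancel₀ hx)

theorem aux_main
    {k 𝔽 : Type*} [Field k] [Field 𝔽]
    (v : AbsoluteValue k ℝ) (hv : IsNonarchimedean v)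
    (π : ValSubring v hv →+* 𝔽)
    (hker : ∀ x : ValSubring v hv, π x = 0 ↔ v (x : k) < 1)
    (d : ℕ) (hd : 2 ≤ d)
    (Φ : Fin 2 → MvPolynomial (Fin 2) k)
    (hhom : ∀ i, (Φ i).IsHomogeneous d)
    (c : kˣ) (A : Fin 2 → MvPolynomial (Fin 2) (ValSubring v hv))
    (hA : ∀ i, MvPolynomial.map (ValSubring v hv).subtype (A i) = (c : k) • Φ i)
    (hAred : IsRelPrime (MvPolynomial.map π (A 0)) (MvPolynomial.map π (A 1)))
    (s : PGL2 k) (hs : s ∈ AutSet Φ) :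
    ∃ (M : GL (Fin 2) k) (N : Matrix (Fin 2) (Fin 2) (ValSubring v hv))
      (lam : ValSubring v hv),
      PGL2.mk M = s ∧
      (∀ i j, (N i j : k) = (M : Matrix (Fin 2) (Fin 2) k) i j) ∧
      IsUnit N.det ∧
      (∀ i, bind₁ A (linForms N i) = C lam * bind₁ (linForms N) (A i)) := by
  obtain ⟨M0, hM0, lam0, h0⟩ := hs
  obtain ⟨⟨i0, j0⟩, hmax⟩ := Finite.exists_max (fun q : Fin 2 × Fin 2 => v (M0.1 q.1 q.2))
  have hne : M0.1 i0 j0 ≠ 0 := by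
    intro hz
    have hall : M0.1 = 0 := by
      ext i j
      have := hmax (i, j)
      simp only [hz, map_zero] at this
      exact (v.eq_zero).1 (le_antisymm this (v.nonneg _))
    have h5 := M0.isUnit
    rw [hall] at h5
    simp at h5
  set a : k := (M0.1 i0 j0)⁻¹ with ha_def
  have ha : a ≠ 0 := inv_ne_zero hne
  have hdet0 : M0.1.det ≠ 0 := ((Matrix.isUnit_iff_isUnit_det _).1 M0.isUnit).ne_zero
  have hdet1 : (a • M0.1).det ≠ 0 := by
    rw [Matrix.det_smul]
    exact mul_ne_zero (pow_ne_zero _ ha) hdet0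
  let M : GL (Fin 2) k := Matrix.GeneralLinearGroup.mkOfDetNeZero (a • M0.1) hdet1
  have hM : M.1 = a • M0.1 := rfl
  have hle : ∀ i j, v ((a • M0.1) i j) ≤ 1 := by
    intro i j
    have := hmax (i, j)
    simp only [Matrix.smul_apply, smul_eq_mul, map_mul, ha_def, map_inv₀]
    have hp : 0 < v (M0.1 i0 j0) := v.pos hne
    rw [inv_mul_le_iff₀ hp]
    simpa using this
  let N : Matrix (Fin 2) (Fin 2) (ValSubring v hv) := fun i j => ⟨(a • M0.1) i j, hle i j⟩
  have hinj : Function.Injective (ValSubring v hv).subtype := Subtype.val_injective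
  have hNM : N.map (ValSubring v hv).subtype = a • M0.1 := rfl
  have hN1 : N i0 j0 = 1 := by
    apply Subtype.ext
    show (a • M0.1) i0 j0 = 1
    simp [ha_def, hne]
  have hdetN : ((N.det : ValSubring v hv) : k) = (a • M0.1).det := by
    have := RingHom.map_det (ValSubring v hv).subtype N
    exact this
  have hAh : ∀ i, (A i).IsHomogeneous d := by
    intro i
    apply MvPolynomial.IsHomogeneous.of_map hinj
    rw [hA, smul_eq_C_mul]
    simpa using (isHomogeneous_C (Fin 2) (c : k)).mul (hhom i)
  obtain ⟨mu, hmu, hconj⟩ := aux_conj_scale hhom (c : k) c.ne_zero M0.1 lam0 lam0.ne_zero h0 a ha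
  have hb1 : ∀ i, MvPolynomial.map (ValSubring v hv).subtype (bind₁ A (linForms N i))
      = bind₁ (fun j => (c : k) • Φ j) (linForms (a • M0.1) i) := by
    intro i
    rw [map_bind₁, aux_map_lin, hNM]
    simp only [hA]
  have hb2 : ∀ i, MvPolynomial.map (ValSubring v hv).subtype (bind₁ (linForms N) (A i))
      = bind₁ (linForms (a • M0.1)) ((c : k) • Φ i) := by
    intro i
    rw [map_bind₁, hA]
    simp only [aux_map_lin, hNM]
  have hpN : π (N i0 j0) ≠ 0 := by simp [hN1]
  have hmu1 : v mu ≤ 1 := by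
    by_contra hgt
    push Not at hgt
    have hlt : v mu⁻¹ < 1 := by
      rw [map_inv₀]
      exact inv_lt_one_of_one_lt₀ hgt
    refine aux_core2 π hAh hAred N i0 j0 hpN ⟨mu⁻¹, hlt.le⟩ ((hker _).2 hlt) ?_
    intro i
    apply MvPolynomial.map_injective _ hinj
    rw [map_mul, hb1, hb2, hconj, map_C, ← mul_assoc, ← C_mul]
    show C (mu⁻¹ * mu) * _ = _
    rw [inv_mul_cancel₀ hmu, C_1, one_mul]
  have heq : ∀ i, bind₁ A (linForms N i)
      = C (⟨mu, hmu1⟩ : ValSubring v hv) * bind₁ (linForms N) (A i) := by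
    intro i
    apply MvPolynomial.map_injective _ hinj
    rw [map_mul, hb1, hb2, hconj, map_C]
    rfl
  refine ⟨M, N, ⟨mu, hmu1⟩, ?_, fun i j => rfl, ?_, heq⟩
  · rw [← hM0]
    refine ((aux_mk_eq _ _).2 ⟨a, ha, ?_⟩).symm
    intro i j
    rw [hM]
    rfl
  · have h1 := aux_core1 π hd hAh hAred N i0 j0 hpN (by
      intro h
      rw [h] at hdetN
      exact hdet1 hdetN.symm) _ heq
    rw [aux_unit]
    have h2 : ¬ _ := fun h => h1 ((hker _).2 h)
    exact le_antisymm N.det.2 (not_lt.1 h2)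

/-- `(M, N, N')` is a good representative of `s` with reduction `r`. -/
def AuxRep {k 𝔽 : Type*} [Field k] [Field 𝔽] (v : AbsoluteValue k ℝ) (hv : IsNonarchimedean v)
    (π : ValSubring v hv →+* 𝔽) (s : PGL2 k) (r : PGL2 𝔽) : Prop :=
  ∃ (M : GL (Fin 2) k) (N : Matrix (Fin 2) (Fin 2) (ValSubring v hv)) (N' : GL (Fin 2) 𝔽),
    PGL2.mk M = s ∧ (∀ i j, (N i j : k) = (M : Matrix (Fin 2) (Fin 2) k) i j) ∧
    IsUnit N.det ∧ (N' : Matrix (Fin 2) (Fin 2) 𝔽) = N.map π ∧ PGL2.mk N' = r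

theorem aux_det_coe {k : Type*} [Field k] (v : AbsoluteValue k ℝ)
    (hv : IsNonarchimedean v) (N : Matrix (Fin 2) (Fin 2) (ValSubring v hv))
    (M : Matrix (Fin 2) (Fin 2) k) (h : ∀ i j, (N i j : k) = M i j) :
    (N.det : k) = M.det := by
  rw [Matrix.det_fin_two, Matrix.det_fin_two, ← h, ← h, ← h, ← h]
  rfl

theorem aux_rep_unique {k 𝔽 : Type*} [Field k] [Field 𝔽] (v : AbsoluteValue k ℝ)
    (hv : IsNonarchimedean v) (π : ValSubring v hv →+* 𝔽) (s : PGL2 k) (r r' : PGL2 𝔽)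
    (h : AuxRep v hv π s r) (h' : AuxRep v hv π s r') : r = r' := by
  obtain ⟨M, N, P, hM, hN, hu, hP, rfl⟩ := h
  obtain ⟨M', N', P', hM', hN', hu', hP', rfl⟩ := h'
  obtain ⟨a, ha, hMM⟩ := (aux_mk_eq M M').1 (hM.trans hM'.symm)
  rw [aux_unit, aux_det_coe v hv _ _ hN] at hu
  rw [aux_unit, aux_det_coe v hv _ _ hN'] at hu'
  have hva : v a = 1 := by
    have h1 : M'.1.det = a ^ 2 * M.1.det := by
      rw [Matrix.det_fin_two, Matrix.det_fin_two]
      simp only [hMM]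
      ring
    rw [h1, map_mul, hu, mul_one, map_pow] at hu'
    exact (pow_eq_one_iff_of_nonneg (v.nonneg a) two_ne_zero).1 hu'
  let a' : ValSubring v hv := ⟨a, hva.le⟩
  have ha' : IsUnit a' := (aux_unit v hv a').2 hva
  refine (aux_mk_eq _ _).2 ⟨π a', (ha'.map π).ne_zero, ?_⟩
  intro i j
  rw [hP, hP', Matrix.map_apply, Matrix.map_apply, ← map_mul]
  congr 1
  apply Subtype.ext
  rw [hN', hMM, ← hN]
  rfl

theorem aux_rep_mul {k 𝔽 : Type*} [Field k] [Field 𝔽] (v : AbsoluteValue k ℝ)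
    (hv : IsNonarchimedean v) (π : ValSubring v hv →+* 𝔽) (s s' : PGL2 k) (r r' : PGL2 𝔽)
    (h : AuxRep v hv π s r) (h' : AuxRep v hv π s' r') : AuxRep v hv π (s * s') (r * r') := by
  obtain ⟨M, N, P, rfl, hN, hu, hP, rfl⟩ := h
  obtain ⟨M', N', P', rfl, hN', hu', hP', rfl⟩ := h'
  refine ⟨M * M', N * N', P * P', rfl, ?_, ?_, ?_, rfl⟩
  · intro i j
    simp [Matrix.mul_apply, Fin.sum_univ_two, ← hN, ← hN']
  · rw [Matrix.det_mul]
    exact hu.mul hu'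
  · rw [Units.val_mul, hP, hP', Matrix.map_mul]

theorem aux_lift_unit {O F : Type*} [CommRing O] [Field F] (p : O →+* F)
    (N : Matrix (Fin 2) (Fin 2) O) (hu : IsUnit N.det) :
    ∃ P : GL (Fin 2) F, (P : Matrix (Fin 2) (Fin 2) F) = N.map p := by
  have h : (N.map p).det ≠ 0 := by
    have h1 : (N.map p).det = p N.det := (RingHom.map_det p N).symm
    rw [h1]
    exact (hu.map p).ne_zero
  exact ⟨Matrix.GeneralLinearGroup.mkOfDetNeZero _ h, rfl⟩

theorem aux_conj_red {F : Type*} [Field F] {A : Fin 2 → MvPolynomial (Fin 2) F} {d : ℕ}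
    (hA : ∀ i, (A i).IsHomogeneous d) (hrel : IsRelPrime (A 0) (A 1))
    (P : GL (Fin 2) F) (lam : F)
    (h : ∀ i, bind₁ A (linForms P.1 i) = C lam * bind₁ (linForms P.1) (A i)) :
    MatConj A A P := by
  have hlam : lam ≠ 0 := by
    rintro rfl
    simp only [aux_bind_lin, C_0, zero_mul] at h
    have hdet : P.1.det ≠ 0 := ((Matrix.isUnit_iff_isUnit_det _).1 P.isUnit).ne_zero
    have hCd : (C P.1.det : MvPolynomial (Fin 2) F) ≠ 0 := by simpa using hdet
    have hD : (C P.1.det : MvPolynomial (Fin 2) F)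
        = C (P.1 0 0) * C (P.1 1 1) - C (P.1 0 1) * C (P.1 1 0) := by
      rw [Matrix.det_fin_two]; simp
    have ha := h 0
    have hb := h 1
    have z0 : A 0 = 0 := by
      apply mul_left_cancel₀ hCd
      rw [hD]
      linear_combination C (P.1 1 1) * ha - C (P.1 0 1) * hb
    have z1 : A 1 = 0 := by
      apply mul_left_cancel₀ hCd
      rw [hD]
      linear_combination C (P.1 0 0) * hb - C (P.1 1 0) * ha
    have := aux_nozero hA hrel (fun _ => 1) (by
      intro i
      fin_cases i <;> simp [z0, z1])
    simpa using congrFun this 0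
  exact ⟨Units.mk0 lam hlam, h⟩

/-- Reduction Lemma, first part. -/
theorem good_reduction_of_aut_and_reduction_hom
    {k 𝔽 : Type*} [Field k] [Field 𝔽]
    (v : AbsoluteValue k ℝ) (hv : IsNonarchimedean v)
    (π : ValSubring v hv →+* 𝔽) (hπ : Function.Surjective π)
    (hker : ∀ x : ValSubring v hv, π x = 0 ↔ v (x : k) < 1)
    (d : ℕ) (hd : 2 ≤ d)
    (Φ : Fin 2 → MvPolynomial (Fin 2) k)
    (hhom : ∀ i, (Φ i).IsHomogeneous d)
    (hrel : IsRelPrime (Φ 0) (Φ 1))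
    -- good reduction data for φ
    (c : kˣ) (A : Fin 2 → MvPolynomial (Fin 2) (ValSubring v hv))
    (hA : ∀ i, MvPolynomial.map (ValSubring v hv).subtype (A i) = (c : k) • Φ i)
    (hAred : IsRelPrime (MvPolynomial.map π (A 0)) (MvPolynomial.map π (A 1))) :
    (∀ s ∈ AutSet Φ, MatGoodRed v hv s) ∧
    ∃ red : PGL2 k → PGL2 𝔽,
      (∀ s ∈ AutSet Φ, red s ∈ AutSet (fun i => MvPolynomial.map π (A i))) ∧
      (∀ s ∈ AutSet Φ, ∀ t ∈ AutSet Φ, red (s * t) = red s * red t) ∧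
      (∀ s ∈ AutSet Φ, ∀ (M : GL (Fin 2) k)
          (N : Matrix (Fin 2) (Fin 2) (ValSubring v hv)),
        PGL2.mk M = s →
        (∀ i j, (N i j : k) = (M : Matrix (Fin 2) (Fin 2) k) i j) →
        IsUnit N.det →
        ∀ N' : GL (Fin 2) 𝔽, (N' : Matrix (Fin 2) (Fin 2) 𝔽) = N.map π →
          red s = PGL2.mk N') := by
  have main := aux_main v hv π hker d hd Φ hhom c A hA hAred
  have hrep : ∀ s ∈ AutSet Φ, ∃ r, AuxRep v hv π s r := by
    intro s hs
    obtain ⟨M, N, lam, hM, hN, hu, -⟩ := main s hs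
    obtain ⟨P, hP⟩ := aux_lift_unit π N hu
    exact ⟨_, M, N, P, hM, hN, hu, hP, rfl⟩
  have hinj : Function.Injective (ValSubring v hv).subtype := Subtype.val_injective
  have hAh : ∀ i, (A i).IsHomogeneous d := by
    intro i
    apply MvPolynomial.IsHomogeneous.of_map hinj
    rw [hA, smul_eq_C_mul]
    simpa using (isHomogeneous_C (Fin 2) (c : k)).mul (hhom i)
  classical
  let red : PGL2 k → PGL2 𝔽 := fun s =>
    if h : ∃ r, AuxRep v hv π s r then h.choose else 1
  have hred : ∀ s r, AuxRep v hv π s r → red s = r := by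
    intro s r h
    have hex : ∃ r, AuxRep v hv π s r := ⟨r, h⟩
    have : red s = hex.choose := dif_pos hex
    rw [this]
    exact aux_rep_unique v hv π s _ _ hex.choose_spec h
  refine ⟨?_, red, ?_, ?_, ?_⟩
  · intro s hs
    obtain ⟨M, N, lam, hM, hN, hu, -⟩ := main s hs
    exact ⟨M, N, hM, hN, hu⟩
  · intro s hs
    obtain ⟨M, N, lam, hM, hN, hu, heq⟩ := main s hs
    obtain ⟨P, hP⟩ := aux_lift_unit π N hu
    rw [hred s (PGL2.mk P) ⟨M, N, P, hM, hN, hu, hP, rfl⟩]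
    refine ⟨P, rfl, aux_conj_red (fun i => (hAh i).map π) hAred P (π lam) ?_⟩
    intro i
    have h := congrArg (MvPolynomial.map π) (heq i)
    rw [map_bind₁, map_mul, map_bind₁, map_C] at h
    simp only [aux_map_lin, ← hP] at h
    exact h
  · intro s hs t ht
    obtain ⟨r, hr⟩ := hrep s hs
    obtain ⟨r', hr'⟩ := hrep t ht
    rw [hred s r hr, hred t r' hr']
    exact hred _ _ (aux_rep_mul v hv π s t r r' hr hr')
  · intro s hs M N hM hN hu N' hN'
    exact hred s _ ⟨M, N, N', hM, hN, hu, hN', rfl⟩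
end
end

section
/- Let k be a field equipped with a non-Archimedean absolute value, with valuation ring 𝔬 and residue field 𝔽, and let φ ∈ k(z) be a rational function of degree at least 2 with good reduction. If 𝔽 has characteristic p > 0, then the kernel of the reduction homomorphism red : Aut_φ(k) → Aut_φ(𝔽) is a p-group (every element of the kernel has p-power order); if 𝔽 has characteristic zero, the kernel is trivial. -/
open MvPolynomial

noncomputable section

lemma hom_aeval_smul {F K : Type*} [CommRing F] [CommRing K] [Algebra F K] {d : ℕ}
    {f : MvPolynomial (Fin 2) F} (hf : f.IsHomogeneous d) (a : K) (x : Fin 2 → K) :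
    aeval (a • x) f = a ^ d * aeval x f := by
  rw [aeval_def, aeval_def, eval₂_eq', eval₂_eq', Finset.mul_sum]
  refine Finset.sum_congr rfl fun m hm => ?_
  have h := hf (mem_support_iff.mp hm)
  rw [← h]
  simp [Finsupp.weight_apply, Finsupp.sum_fintype, mul_pow, pow_add]
  ring


lemma nozero_aux {F K : Type*} [Field F] [Field K] [Algebra F K] [Algebra.IsAlgebraic F K] {d : ℕ}
    {f : Fin 2 → MvPolynomial (Fin 2) F} (hf : ∀ i, (f i).IsHomogeneous d)
    (hrel : IsRelPrime (f 0) (f 1)) (u : Fin 2 → K) (hu : ∀ i, aeval u (f i) = 0) : u 1 = 0 := by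
  by_contra h1
  set t := u 0 / u 1 with ht
  have hu' : u = u 1 • ![t, 1] := by
    ext i; fin_cases i
    · simp [ht]; field_simp
    · simp
  have hz : ∀ i, aeval ![t, 1] (f i) = 0 := by
    intro i
    have := hu i
    rw [hu', hom_aeval_smul (hf i)] at this
    rcases mul_eq_zero.mp this with h | h
    · exact absurd h (pow_ne_zero _ h1)
    · exact h
  have hint : IsIntegral F t := Algebra.IsIntegral.isIntegral t
  set q := minpoly F t
  have hdvd : ∀ i, Polynomial.homogenize q q.natDegree ∣ f i := by
    intro i
    set g : Polynomial F := aeval ![Polynomial.X, 1] (f i) with hg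
    have hgf : Polynomial.homogenize g d = f i :=
      Polynomial.homogenize_eq_of_isHomogeneous (hf i) hg.symm
    have hgd : g.natDegree ≤ d := by
      refine (MvPolynomial.aeval_natDegree_le (f i) (hf i).totalDegree_le _ (n := 1) ?_).trans (by simp)
      intro j; fin_cases j <;> simp
    have hgt : Polynomial.aeval t g = 0 := by
      rw [hg, ← hz i, ← AlgHom.comp_apply]
      congr 1
      ext j; fin_cases j <;> simp
    obtain ⟨r, hr⟩ := minpoly.dvd F t hgt
    by_cases hr0 : r = 0
    · rw [← hgf, hr, hr0]; simp
    have hdeg : g.natDegree = q.natDegree + r.natDegree := by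
      rw [hr, Polynomial.natDegree_mul (minpoly.ne_zero hint) hr0]
    have : d = q.natDegree + (d - q.natDegree) := by omega
    rw [← hgf, hr, this, Polynomial.homogenize_mul _ _ le_rfl (by omega)]
    exact dvd_mul_right _ _
  have hunit := hrel (hdvd 0) (hdvd 1)
  have := hunit.map (aeval (R := F) ![t, 1])
  rw [Polynomial.aeval_homogenize_of_eq_one le_rfl _ (by simp)] at this
  simp [q, minpoly.aeval] at this

lemma nozero {F K : Type*} [Field F] [Field K] [Algebra F K] [Algebra.IsAlgebraic F K] {d : ℕ}
    {f : Fin 2 → MvPolynomial (Fin 2) F} (hf : ∀ i, (f i).IsHomogeneous d)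
    (hrel : IsRelPrime (f 0) (f 1)) (u : Fin 2 → K) (hu : ∀ i, aeval u (f i) = 0) : u = 0 := by
  have h1 := nozero_aux hf hrel u hu
  let e := renameEquiv F (Equiv.swap (0 : Fin 2) 1)
  have hee : ∀ g, e (e g) = g := by
    intro g; simp [e, rename_rename, ← Equiv.coe_trans]
  have h0 := nozero_aux (f := fun i => e (f i)) (d := d) (fun i => (hf i).rename_isHomogeneous)
    (by
      refine IsRelPrime.of_map (f := e) ?_
      simpa only [hee] using hrel) (u ∘ Equiv.swap 0 1) (by
      intro i
      simp only [e, renameEquiv_apply, aeval_rename]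
      rw [Function.comp_assoc]
      simpa [← Equiv.coe_trans] using hu i)
  ext i; fin_cases i
  · simpa using h0
  · simpa using h1

def luc {R : Type*} [CommRing R] (τ δ : R) : ℕ → R × R
  | 0 => (0, 1)
  | n + 1 => (τ * (luc τ δ n).1 + (luc τ δ n).2, - δ * (luc τ δ n).1)

lemma luc_pow {R : Type*} [CommRing R] {τ δ a : R} (h : a ^ 2 = τ * a - δ) (n : ℕ) :
    a ^ n = (luc τ δ n).1 * a + (luc τ δ n).2 := by
  induction n with
  | zero => simp [luc]
  | succ n ih =>
    rw [pow_succ, ih]; simp only [luc]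
    linear_combination (luc τ δ n).1 * h

lemma luc_mat {R : Type*} [CommRing R] (M : Matrix (Fin 2) (Fin 2) R) (n : ℕ) :
    M ^ n = (luc M.trace M.det n).1 • M + (luc M.trace M.det n).2 • (1 : Matrix (Fin 2) (Fin 2) R) := by
  induction n with
  | zero => simp [luc]
  | succ n ih =>
    rw [pow_succ, ih]; simp only [luc]
    generalize (luc M.trace M.det n).1 = P
    generalize (luc M.trace M.det n).2 = Q
    ext i j
    fin_cases i <;> fin_cases j <;>
      simp [Matrix.mul_apply, Fin.sum_univ_two, Matrix.det_fin_two, Matrix.trace_fin_two] <;> ring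

lemma luc_map {R S : Type*} [CommRing R] [CommRing S] (f : R →+* S) (τ δ : R) (n : ℕ) :
    f (luc τ δ n).1 = (luc (f τ) (f δ) n).1 ∧ f (luc τ δ n).2 = (luc (f τ) (f δ) n).2 := by
  induction n with
  | zero => simp [luc]
  | succ n ih => simp [luc, ih.1, ih.2]

lemma luc_double {R : Type*} [CommRing R] (a : R) (n : ℕ) :
    (luc (2 * a) (a ^ 2) (n + 1)).1 = (n + 1) * a ^ n ∧
    (luc (2 * a) (a ^ 2) (n + 1)).2 = - n * a ^ (n + 1) := by
  induction n with
  | zero => simp [luc]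
  | succ n ih =>
    rw [luc, ih.1, ih.2]; push_cast
    constructor <;> ring

/-- unipotent case is impossible in characteristic zero -/
lemma no_unipotent {K : Type*} [Field K] [CharZero K] {d : ℕ} (hd : 2 ≤ d)
    (E : (Fin 2 → K) → (Fin 2 → K))
    (hE : ∀ (a : K) x, E (a • x) = a ^ d • E x)
    (hE0 : ∀ x, E x = 0 → x = 0)
    (hpoly : ∀ u w i, ∃ q : Polynomial K, ∀ s, q.eval s = E (u + s • w) i)
    (N : Matrix (Fin 2) (Fin 2) K) (hN : N * N = 0)
    (h : ∀ x, E x + N.mulVec (E x) = E (x + N.mulVec x)) : N = 0 := by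
  have hNN : ∀ x, N.mulVec (N.mulVec x) = 0 := fun x => by
    rw [Matrix.mulVec_mulVec, hN, Matrix.zero_mulVec]
  have hit : ∀ (x) (j : ℕ), E x + (j : K) • N.mulVec (E x) = E (x + (j : K) • N.mulVec x) := by
    intro x j
    induction j with
    | zero => simp
    | succ j ih =>
      have := h (x + (j : K) • N.mulVec x)
      rw [← ih] at this
      simp only [Matrix.mulVec_add, Matrix.mulVec_smul, hNN, smul_zero, add_zero] at this
      push_cast
      rw [add_smul, add_smul, one_smul, one_smul, ← add_assoc, ← add_assoc]
      exact this
  have key : ∀ w, N.mulVec w = 0 := by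
    intro w
    apply hE0
    ext i
    obtain ⟨q, hq⟩ := hpoly (N.mulVec w) w i
    let r : Polynomial K := Polynomial.C (E w i) * Polynomial.X ^ d
      + Polynomial.C (N.mulVec (E w) i) * Polynomial.X ^ (d - 1)
    have hqr : q = r := by
      apply Polynomial.eq_of_infinite_eval_eq
      refine Set.infinite_of_injective_forall_mem (f := fun n : ℕ => ((n : K) + 1)⁻¹) ?_ ?_
      · intro a b hab
        simpa using hab
      · intro n
        have hn : ((n : K) + 1) ≠ 0 := Nat.cast_add_one_ne_zero n
        have h1 := hit w (n + 1)
        have h2 : w + ((n + 1 : ℕ) : K) • N.mulVec w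
            = ((n : K) + 1) • (N.mulVec w + ((n : K) + 1)⁻¹ • w) := by
          rw [smul_add, smul_smul, mul_inv_cancel₀ hn, one_smul, add_comm]; push_cast; rfl
        rw [h2, hE] at h1
        have h3 := congrFun h1 i
        simp only [Pi.add_apply, Pi.smul_apply, smul_eq_mul] at h3
        push_cast at h3
        show q.eval _ = r.eval _
        rw [hq]
        simp only [r, Polynomial.eval_add, Polynomial.eval_mul, Polynomial.eval_C,
          Polynomial.eval_pow, Polynomial.eval_X]
        obtain ⟨e, rfl⟩ : ∃ e, d = e + 1 := ⟨d - 1, by omega⟩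
        simp only [Nat.add_sub_cancel]
        apply mul_left_cancel₀ (pow_ne_zero (e + 1) hn)
        rw [← h3, inv_pow, inv_pow]
        field_simp
        ring
    have := hq 0
    rw [hqr] at this
    simp [r, show d ≠ 0 by omega, show d - 1 ≠ 0 by omega] at this
    simpa using this.symm
  ext i j
  have := congrFun (key (Pi.single j 1)) i
  simpa using this

lemma eig_root {K : Type*} [Field K] (M : Matrix (Fin 2) (Fin 2) K) (α β : K)
    (ht : M.trace = α + β) (hdt : M.det = α * β) (μ : K) (y : Fin 2 → K) (hy : y ≠ 0)
    (h : M.mulVec y = μ • y) : μ = α ∨ μ = β := by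
  have h1 : (M - μ • (1 : Matrix (Fin 2) (Fin 2) K)).det = 0 := by
    rw [← Matrix.exists_mulVec_eq_zero_iff]
    exact ⟨y, hy, by rw [Matrix.sub_mulVec, h, Matrix.smul_mulVec, Matrix.one_mulVec, sub_self]⟩
  have h2 : (μ - α) * (μ - β) = 0 := by
    rw [Matrix.det_fin_two] at h1 hdt
    rw [Matrix.trace_fin_two] at ht
    simp at h1
    linear_combination h1 - hdt - μ * (ht)* (-1)
  rcases mul_eq_zero.mp h2 with h | h
  · left; linear_combination h
  · right; linear_combination h

lemma eig_exists {K : Type*} [Field K] (M : Matrix (Fin 2) (Fin 2) K) (α β : K)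
    (ht : M.trace = α + β) (hdt : M.det = α * β) : ∃ y : Fin 2 → K, y ≠ 0 ∧ M.mulVec y = α • y := by
  have h1 : (M - α • (1 : Matrix (Fin 2) (Fin 2) K)).det = 0 := by
    rw [Matrix.det_fin_two] at hdt ⊢
    rw [Matrix.trace_fin_two] at ht
    simp
    linear_combination hdt - α * ht
  obtain ⟨y, hy, h⟩ := Matrix.exists_mulVec_eq_zero_iff.mpr h1
  refine ⟨y, hy, ?_⟩
  rw [Matrix.sub_mulVec, Matrix.smul_mulVec, Matrix.one_mulVec] at h
  exact sub_eq_zero.mp h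

lemma fin_order_K {K : Type*} [Field K] [IsAlgClosed K] {d : ℕ} (hd : 2 ≤ d)
    (E : (Fin 2 → K) → (Fin 2 → K))
    (hE : ∀ (a : K) x, E (a • x) = a ^ d • E x)
    (hE0 : ∀ x, E x = 0 → x = 0)
    (hpoly : ∀ u w i, ∃ q : Polynomial K, ∀ s, q.eval s = E (u + s • w) i)
    (M : Matrix (Fin 2) (Fin 2) K) (hM : M.det ≠ 0) (l : K)
    (h : ∀ x, M.mulVec (E x) = l • E (M.mulVec x)) :
    ∃ n, 1 ≤ n ∧ ∃ q : K, M ^ n = q • (1 : Matrix (Fin 2) (Fin 2) K) := by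
  obtain ⟨α, β, ht, hdt⟩ : ∃ α β, M.trace = α + β ∧ M.det = α * β := by
    obtain ⟨α, hα⟩ := IsAlgClosed.exists_root
      (Polynomial.X ^ 2 - Polynomial.C M.trace * Polynomial.X + Polynomial.C M.det) (by
        have : (Polynomial.X ^ 2 - Polynomial.C M.trace * Polynomial.X + Polynomial.C M.det).degree = 2 := by
          compute_degree!
        rw [this]; decide)
    simp at hα
    exact ⟨α, M.trace - α, by ring, by linear_combination hα⟩
  have hα0 : α ≠ 0 := by rintro rfl; simp [hdt] at hM
  have hβ0 : β ≠ 0 := by rintro rfl; simp [hdt] at hM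
  have hev : ∀ (μ : K) (y : Fin 2 → K), y ≠ 0 → M.mulVec y = μ • y → l * μ ^ d = α ∨ l * μ ^ d = β := by
    intro μ y hy hy'
    refine eig_root M α β ht hdt _ (E y) (fun h0 => hy (hE0 _ h0)) ?_
    rw [h, hy', hE, smul_smul]
  obtain ⟨u, hu, hu'⟩ := eig_exists M α β ht hdt
  obtain ⟨w, hw, hw'⟩ := eig_exists M β α (by rw [ht]; ring) (by rw [hdt]; ring)
  have h1 := hev _ _ hu hu'
  have h2 := hev _ _ hw hw'
  by_cases hab : α = β
  · subst hab
    have h1 : l * α ^ d = α := by tauto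
    have ht' : M.trace = 2 * α := by rw [ht]; ring
    have hdt' : M.det = α ^ 2 := by rw [hdt]; ring
    obtain ⟨p, hp⟩ := CharP.exists K
    rcases CharP.char_is_prime_or_zero K p with hpp | rfl
    · refine ⟨p, hpp.one_le, (luc (2 * α) (α ^ 2) p).2, ?_⟩
      rw [luc_mat, ht', hdt']
      obtain ⟨m, rfl⟩ : ∃ m, p = m + 1 := ⟨p - 1, by have := hpp.one_le; omega⟩
      have hc : ((m + 1 : ℕ) : K) = 0 := CharP.cast_eq_zero K (m + 1)
      push_cast at hc
      rw [(luc_double α m).1, hc]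
      simp
    · have : CharZero K := CharP.charP_to_charZero K
      refine ⟨1, le_rfl, α, ?_⟩
      have := no_unipotent hd E hE hE0 hpoly (α⁻¹ • M - 1) ?_ ?_
      · rw [pow_one]
        have h3 : α⁻¹ • M = 1 := sub_eq_zero.mp this
        rw [← h3, smul_smul, mul_inv_cancel₀ hα0, one_smul]
      · rw [Matrix.trace_fin_two] at ht'
        rw [Matrix.det_fin_two] at hdt'
        have e11 : M 1 1 = 2 * α - M 0 0 := by linear_combination ht'
        have e12 : M 0 1 * M 1 0 = - (M 0 0 - α) ^ 2 := by
          rw [e11] at hdt'; linear_combination - hdt'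
        ext i j
        fin_cases i <;> fin_cases j <;> simp [Matrix.mul_apply, Fin.sum_univ_two] <;>
          field_simp <;> try rw [e11]
        · linear_combination e12
        · ring
        · ring
        · linear_combination e12
      · intro x
        rw [Matrix.sub_mulVec, Matrix.sub_mulVec, Matrix.one_mulVec, Matrix.one_mulVec,
          Matrix.smul_mulVec, Matrix.smul_mulVec, add_sub_cancel, add_sub_cancel, h, hE, smul_smul]
        congr 1
        rw [inv_pow]
        field_simp
        linear_combination h1
  · have hsuff : ∀ n, 1 ≤ n → α ^ n = β ^ n → ∃ n, 1 ≤ n ∧ ∃ q : K, M ^ n = q • (1 : Matrix (Fin 2) (Fin 2) K) := by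
      intro n hn hpow
      refine ⟨n, hn, (luc M.trace M.det n).2, ?_⟩
      rw [luc_pow (a := α) (τ := M.trace) (δ := M.det) (by rw [ht, hdt]; ring) n,
        luc_pow (a := β) (τ := M.trace) (δ := M.det) (by rw [ht, hdt]; ring) n] at hpow
      have : (luc M.trace M.det n).1 * (α - β) = 0 := by linear_combination hpow
      have hP : (luc M.trace M.det n).1 = 0 := (mul_eq_zero.mp this).resolve_right (sub_ne_zero.mpr hab)
      conv_lhs => rw [luc_mat, hP, zero_smul, zero_add]
    have hl : l ≠ 0 := by
      rintro rfl
      rcases h1 with h1 | h1 <;> simp at h1 <;> [exact hα0 h1.symm; exact hβ0 h1.symm]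
    obtain ⟨e, rfl⟩ : ∃ e, d = e + 1 := ⟨d - 1, by omega⟩
    rcases h1 with h1 | h1 <;> rcases h2 with h2 | h2
    · refine hsuff (e + 1) (by omega) (mul_left_cancel₀ hl (h1.trans h2.symm))
    · refine hsuff e (by omega) (mul_left_cancel₀ hl ?_)
      have a1 : l * α ^ e = 1 := mul_right_cancel₀ hα0 (by linear_combination h1)
      have a2 : l * β ^ e = 1 := mul_right_cancel₀ hβ0 (by linear_combination h2)
      rw [a1, a2]
    · refine hsuff (e + 2) (by omega) (mul_left_cancel₀ hl ?_)
      linear_combination α * h1 - β * h2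
    · refine hsuff (e + 1) (by omega) (mul_left_cancel₀ hl (h1.trans h2.symm))

lemma conj_pt {k K : Type*} [Field k] [Field K] [Algebra k K]
    {Φ : Fin 2 → MvPolynomial (Fin 2) k} {M : Matrix (Fin 2) (Fin 2) k} {l : k}
    (h : ∀ i, bind₁ Φ (linForms M i) = C l * bind₁ (linForms M) (Φ i)) (x : Fin 2 → K) :
    (M.map (algebraMap k K)).mulVec (fun j => aeval x (Φ j)) =
      algebraMap k K l • (fun j => aeval ((M.map (algebraMap k K)).mulVec x) (Φ j)) := by
  ext i
  have h1 := congrArg (aeval x) (h i)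
  rw [map_mul, aeval_bind₁, aeval_bind₁] at h1
  have h2 : (fun j => aeval x (linForms M j)) = (M.map (algebraMap k K)).mulVec x := by
    ext j
    simp [linForms, Matrix.mulVec, dotProduct, Fin.sum_univ_two]
  rw [h2] at h1
  simpa [linForms, Matrix.mulVec, dotProduct, Fin.sum_univ_two] using h1

lemma fin_order {k : Type*} [Field k] {d : ℕ} (hd : 2 ≤ d)
    {Φ : Fin 2 → MvPolynomial (Fin 2) k} (hhom : ∀ i, (Φ i).IsHomogeneous d)
    (hrel : IsRelPrime (Φ 0) (Φ 1)) {M : Matrix (Fin 2) (Fin 2) k} (hM : M.det ≠ 0) {l : k}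
    (h : ∀ i, bind₁ Φ (linForms M i) = C l * bind₁ (linForms M) (Φ i)) :
    ∃ n, 1 ≤ n ∧ ∃ q : k, M ^ n = q • (1 : Matrix (Fin 2) (Fin 2) k) := by
  let K := AlgebraicClosure k
  obtain ⟨n, hn, q, hq⟩ := fin_order_K hd (fun (x : Fin 2 → K) j => aeval x (Φ j))
    (by intro a x; ext j; simp [hom_aeval_smul (hhom j)])
    (by intro x hx; exact nozero hhom hrel x (fun i => congrFun hx i))
    (by
      intro u w i
      refine ⟨aeval (fun j => Polynomial.C (u j) + Polynomial.X * Polynomial.C (w j)) (Φ i), fun s => ?_⟩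
      show Polynomial.eval s _ = aeval (u + s • w) (Φ i)
      rw [← Polynomial.coe_aeval_eq_eval, ← AlgHom.restrictScalars_apply k]
      change ((Polynomial.aeval s).restrictScalars k) _ = _
      rw [← AlgHom.comp_apply]
      congr 1
      ext j
      simp
      ring)
    (M.map (algebraMap k K))
    (by
      have := (RingHom.map_det (algebraMap k K) M)
      rw [RingHom.mapMatrix_apply] at this
      rw [← this]; simpa using hM)
    (algebraMap k K l) (fun x => conj_pt h x)
  refine ⟨n, hn, (M ^ n) 0 0, ?_⟩
  have hpow : (M ^ n).map (algebraMap k K) = q • 1 := by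
    rw [← hq]; exact map_pow (algebraMap k K).mapMatrix M n
  have he : ∀ i j, algebraMap k K ((M ^ n) i j) = (q • (1 : Matrix (Fin 2) (Fin 2) K)) i j := by
    intro i j; rw [← hpow]; rfl
  have h01 := he 0 1
  have h10 := he 1 0
  have h00 := he 0 0
  have h11 := he 1 1
  simp at h01 h10 h00 h11
  have h2 : (M ^ n) 1 1 = (M ^ n) 0 0 := (algebraMap k K).injective (h11.trans h00.symm)
  ext i j
  fin_cases i <;> fin_cases j <;> simp [h01, h10, h2]

section val
variable {k : Type*} [Field k] {v : AbsoluteValue k ℝ} {hv : IsNonarchimedean v}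

lemma val_le (x : ValSubring v hv) : v (x : k) ≤ 1 := x.2

lemma val_isUnit (x : ValSubring v hv) (h : v (x : k) = 1) : IsUnit x := by
  have h0 : (x : k) ≠ 0 := by intro h0; simp [h0] at h
  refine IsUnit.of_mul_eq_one ⟨(x : k)⁻¹, ?_⟩ ?_
  · show v _ ≤ 1
    rw [map_inv₀, h]; simp
  · ext; simp [h0]

lemma det_good {d : ℕ} (hd : 2 ≤ d) (G : (Fin 2 → ValSubring v hv) → (Fin 2 → ValSubring v hv))
    (hG : ∀ (a : ValSubring v hv) x, G (a • x) = a ^ d • G x)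
    (hprim : ∀ x, (∃ i, v (x i : k) = 1) → ∃ i, v (G x i : k) = 1)
    (N : Matrix (Fin 2) (Fin 2) (ValSubring v hv)) (l : k)
    (h : ∀ x i, ((N.mulVec (G x) i : ValSubring v hv) : k) = l * (G (N.mulVec x) i : k))
    (hN : ∃ i j, v (N i j : k) = 1) (hdet : N.det ≠ 0) : IsUnit N.det := by
  obtain ⟨i0, j0, hij⟩ := hN
  have hl : v l ≤ 1 := by
    obtain ⟨i, hi⟩ := hprim (N.mulVec (Pi.single j0 1)) ⟨i0, by simpa using hij⟩
    have h1 := congrArg v (h (Pi.single j0 1) i)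
    rw [map_mul, hi, mul_one] at h1
    rw [← h1]; exact val_le _
  obtain ⟨e, x, hx, hNx, he⟩ : ∃ e x : Fin 2 → ValSubring v hv, (∃ i, v (x i : k) = 1) ∧
      N.mulVec x = N.det • e ∧ True := by
    let e : Fin 2 → ValSubring v hv := Pi.single (1 - i0) 1
    refine ⟨e, N.adjugate.mulVec e, ⟨1 - j0, ?_⟩, ?_, trivial⟩
    · simp only [e, Matrix.mulVec_single_one, Matrix.col_apply, Matrix.adjugate_fin_two]
      fin_cases i0 <;> fin_cases j0 <;> simpa using hij
    · rw [Matrix.mulVec_mulVec, Matrix.mul_adjugate, Matrix.smul_mulVec, Matrix.one_mulVec]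
  obtain ⟨i, hi⟩ := hprim x hx
  have h1 : ((N.det : ValSubring v hv) : k) * (G x i : k) =
      l * ((N.det : ValSubring v hv) : k) ^ d * ((N.adjugate.mulVec (G e) i : ValSubring v hv) : k) := by
    have h2 : N.adjugate.mulVec (N.mulVec (G x)) i = N.det * G x i := by
      rw [Matrix.mulVec_mulVec, Matrix.adjugate_mul, Matrix.smul_mulVec, Matrix.one_mulVec]; rfl
    have h3 := congrArg (fun z : ValSubring v hv => (z : k)) h2
    simp only [Subring.coe_mul] at h3
    rw [← h3]
    have h4 := fun i => h x i
    rw [hNx, hG] at h4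
    simp only [Matrix.mulVec, dotProduct, Fin.sum_univ_two, Pi.smul_apply, smul_eq_mul,
      Subring.coe_add, Subring.coe_mul, Subring.coe_pow] at h4 ⊢
    rw [h4, h4]; ring
  set δ := ((N.det : ValSubring v hv) : k) with hδ
  have hδ0 : 0 < v δ := v.pos (by simpa [hδ] using hdet)
  have h5 := congrArg v h1
  rw [map_mul, map_mul, map_mul, map_pow, hi, mul_one] at h5
  have h6 : v δ ≤ v δ ^ d := by
    rw [h5]
    rw [← h5]
    calc v δ = v l * v δ ^ d * v ((N.adjugate.mulVec (G e) i : ValSubring v hv) : k) := h5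
      _ ≤ 1 * v δ ^ d * 1 := by
        gcongr
        exact val_le _
      _ = _ := by ring
  apply val_isUnit
  by_contra hne
  have hlt : v δ < 1 := lt_of_le_of_ne (val_le _) hne
  have : v δ ^ d < v δ ^ 1 := pow_lt_pow_right_of_lt_one₀ hδ0 hlt (by omega)
  rw [pow_one] at this
  linarith

lemma exists_scale (M : Matrix (Fin 2) (Fin 2) k) (hM : M.det ≠ 0) :
    ∃ (a : k) (N : Matrix (Fin 2) (Fin 2) (ValSubring v hv)), a ≠ 0 ∧
      (∀ i j, (N i j : k) = a * M i j) ∧ ∃ i j, v (N i j : k) = 1 := by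
  obtain ⟨⟨i0, j0⟩, h⟩ := Finite.exists_max (fun ij : Fin 2 × Fin 2 => v (M ij.1 ij.2))
  have hne : M i0 j0 ≠ 0 := by
    intro h0
    apply hM
    have : ∀ i j, M i j = 0 := by
      intro i j
      have := h (i, j)
      simp only [h0, map_zero] at this
      exact (v.nonpos_iff).mp this
    simp [Matrix.det_fin_two, this]
  have hpos : 0 < v (M i0 j0) := v.pos hne
  refine ⟨(M i0 j0)⁻¹, fun i j => ⟨(M i0 j0)⁻¹ * M i j, ?_⟩, inv_ne_zero hne, fun i j => rfl, i0, j0, ?_⟩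
  · show v _ ≤ 1
    rw [map_mul, map_inv₀, inv_mul_le_iff₀ hpos, mul_one]
    exact h (i, j)
  · simp [hne]

end val

lemma scalar_of_pow {R 𝔽 : Type*} [CommRing R] [IsDomain R] [Field 𝔽] (π : R →+* 𝔽)
    (N : Matrix (Fin 2) (Fin 2) R) (a : 𝔽) (ha : a ≠ 0) (hN : N.map π = a • (1 : Matrix (Fin 2) (Fin 2) 𝔽))
    (m : ℕ) (hm : (m : 𝔽) ≠ 0) (h01 : (N ^ m) 0 1 = 0) (h10 : (N ^ m) 1 0 = 0)
    (h11 : (N ^ m) 0 0 = (N ^ m) 1 1) : N 0 1 = 0 ∧ N 1 0 = 0 ∧ N 0 0 = N 1 1 := by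
  have he : ∀ i j, π (N i j) = (a • (1 : Matrix (Fin 2) (Fin 2) 𝔽)) i j := by
    intro i j; rw [← hN]; rfl
  have e01 := he 0 1
  have e10 := he 1 0
  have e00 := he 0 0
  have e11 := he 1 1
  simp at e01 e10 e00 e11
  have hP : (luc N.trace N.det m).1 ≠ 0 := by
    intro h0
    have h1 := (luc_map π N.trace N.det m).1
    rw [h0, map_zero, show π N.trace = 2 * a by simp [Matrix.trace_fin_two, e00, e11]; ring,
      show π N.det = a ^ 2 by simp [Matrix.det_fin_two, e00, e11, e01, e10]; ring] at h1
    cases m with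
    | zero => simp at hm
    | succ m =>
      rw [(luc_double a m).1] at h1
      push_cast at hm
      exact mul_ne_zero hm (pow_ne_zero _ ha) h1.symm
  rw [luc_mat] at h01 h10 h11
  simp [hP] at h01 h10 h11
  exact ⟨h01, h10, h11⟩

lemma pgl_mk_eq_one {F : Type*} [Field F] (g : GL (Fin 2) F) :
    PGL2.mk g = 1 ↔ g.val 0 1 = 0 ∧ g.val 1 0 = 0 ∧ g.val 0 0 = g.val 1 1 := by
  unfold PGL2.mk
  rw [QuotientGroup.eq_one_iff, Matrix.GeneralLinearGroup.mem_center_iff_val_mem_range_scalar]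
  constructor
  · rintro ⟨a, ha⟩
    rw [← ha]; simp
  · rintro ⟨h1, h2, h3⟩
    refine ⟨g.val 0 0, ?_⟩
    ext i j
    fin_cases i <;> fin_cases j <;> simp [h1, h2, h3]

/-- Reduction Lemma, kernel of reduction. -/
theorem kernel_of_reduction_is_p_group
    {k 𝔽 : Type*} [Field k] [Field 𝔽]
    (v : AbsoluteValue k ℝ) (hv : IsNonarchimedean v)
    (π : ValSubring v hv →+* 𝔽) (hπ : Function.Surjective π)
    (hker : ∀ x : ValSubring v hv, π x = 0 ↔ v (x : k) < 1)
    (d : ℕ) (hd : 2 ≤ d)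
    (Φ : Fin 2 → MvPolynomial (Fin 2) k)
    (hhom : ∀ i, (Φ i).IsHomogeneous d)
    (hrel : IsRelPrime (Φ 0) (Φ 1))
    -- good reduction data for φ
    (c : kˣ) (A : Fin 2 → MvPolynomial (Fin 2) (ValSubring v hv))
    (hA : ∀ i, MvPolynomial.map (ValSubring v hv).subtype (A i) = (c : k) • Φ i)
    (hAred : IsRelPrime (MvPolynomial.map π (A 0)) (MvPolynomial.map π (A 1)))
    -- the reduction homomorphism
    (red : PGL2 k → PGL2 𝔽)
    (hredhom : ∀ s ∈ AutSet Φ, ∀ t ∈ AutSet Φ, red (s * t) = red s * red t)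
    (hredcompat : ∀ s ∈ AutSet Φ, ∀ (M : GL (Fin 2) k)
        (N : Matrix (Fin 2) (Fin 2) (ValSubring v hv)),
      PGL2.mk M = s →
      (∀ i j, (N i j : k) = (M : Matrix (Fin 2) (Fin 2) k) i j) →
      IsUnit N.det →
      ∀ N' : GL (Fin 2) 𝔽, (N' : Matrix (Fin 2) (Fin 2) 𝔽) = N.map π →
        red s = PGL2.mk N') :
    ∀ s ∈ AutSet Φ, red s = 1 →
      ∀ p : ℕ, CharP 𝔽 p →
        (p ≠ 0 → ∃ m : ℕ, orderOf s = p ^ m) ∧ (p = 0 → s = 1) := by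
  
  intro s hs hred p hp
  obtain ⟨M, hMs, l, hl⟩ := id hs
  have hMdet : (M : Matrix (Fin 2) (Fin 2) k).det ≠ 0 := by
    have := (Matrix.isUnit_iff_isUnit_det _).mp M.isUnit
    exact this.ne_zero
  obtain ⟨a, N, ha, hN, hN1⟩ := exists_scale (v := v) (hv := hv) (M : Matrix (Fin 2) (Fin 2) k) hMdet
  -- the polynomials `A i` are homogeneous
  have hAhom : ∀ i, (A i).IsHomogeneous d := by
    intro i
    refine IsHomogeneous.of_map (f := (ValSubring v hv).subtype) Subtype.val_injective ?_
    rw [hA i]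
    exact Submodule.smul_mem (homogeneousSubmodule (Fin 2) k d) _ (hhom i)
  let G : (Fin 2 → ValSubring v hv) → (Fin 2 → ValSubring v hv) := fun x i => aeval x (A i)
  have hGE : ∀ x i, (G x i : k) = c * aeval (fun j => (x j : k)) (Φ i) := by
    intro x i
    have h1 : aeval (fun j => (x j : k)) (MvPolynomial.map (ValSubring v hv).subtype (A i)) =
        (G x i : k) := by
      have := map_eval₂Hom (RingHom.id _) x (ValSubring v hv).subtype (A i)
      simp only [G]
      rw [aeval_def, eval₂_map]
      exact this.symm
    rw [← h1, hA i, map_smul, smul_eq_mul]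
  have hGpi : ∀ x i, π (G x i) = aeval (fun j => π (x j)) (MvPolynomial.map π (A i)) := by
    intro x i
    have := map_eval₂Hom (RingHom.id _) x π (A i)
    rw [aeval_def, eval₂_map]
    exact this
  have hpi1 : ∀ x : ValSubring v hv, v (x : k) = 1 ↔ π x ≠ 0 := by
    intro x
    rw [Ne, hker, not_lt]
    exact ⟨fun h => h.ge, fun h => le_antisymm (val_le x) h⟩
  have hunit : IsUnit N.det := by
    refine det_good hd G ?_ ?_ N (a * l * a⁻¹ ^ d) ?_ hN1 ?_
    · intro b x; ext1 i
      exact hom_aeval_smul (hAhom i) b x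
    · rintro x ⟨i, hi⟩
      by_contra hcon
      push Not at hcon
      have hz := nozero (K := 𝔽) (f := fun i => MvPolynomial.map π (A i)) (d := d)
        (fun i => (hAhom i).map π) hAred (fun j => π (x j)) (by
          intro j
          rw [← hGpi]
          by_contra h
          exact hcon j ((hpi1 _).mpr h))
      exact (hpi1 _).mp hi (congrFun hz i)
    · intro x i
      have h1 := congrFun (conj_pt hl (fun j => (x j : k))) i
      have h2 : (fun j => ((N.mulVec x j : ValSubring v hv) : k)) =
          a • ((M : Matrix (Fin 2) (Fin 2) k).map (algebraMap k k)).mulVec (fun j => (x j : k)) := by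
        ext j
        fin_cases j <;> simp [Matrix.mulVec, dotProduct, Fin.sum_univ_two, hN] <;> ring
      rw [hGE, h2, hom_aeval_smul (hhom i)]
      simp only [Matrix.mulVec, dotProduct, Fin.sum_univ_two, Subring.coe_add, Subring.coe_mul,
        hGE, hN, Matrix.map_apply, Algebra.algebraMap_self, RingHom.id_apply, Pi.smul_apply,
        smul_eq_mul] at h1 ⊢
      rw [inv_pow]
      field_simp
      linear_combination h1
    · intro h0
      have h1 : ((N.det : ValSubring v hv) : k) = a ^ 2 * (M : Matrix (Fin 2) (Fin 2) k).det := by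
        simp [Matrix.det_fin_two, hN]; ring
      rw [h0] at h1
      exact mul_ne_zero (pow_ne_zero 2 ha) hMdet h1.symm
  -- the rescaled representative
  let M' : GL (Fin 2) k := Matrix.GeneralLinearGroup.scalar (Fin 2) (Units.mk0 a ha) * M
  have hM'v : (M' : Matrix (Fin 2) (Fin 2) k) = a • (M : Matrix (Fin 2) (Fin 2) k) := by
    ext i j
    simp [M']
  have hM's : PGL2.mk M' = s := by
    have h1 : PGL2.mk M' = PGL2.mk (Matrix.GeneralLinearGroup.scalar (Fin 2) (Units.mk0 a ha)) *
      PGL2.mk M := rfl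
    rw [h1, (pgl_mk_eq_one _).mpr (by simp), one_mul, hMs]
  have hNM : ∀ i j, (N i j : k) = (M' : Matrix (Fin 2) (Fin 2) k) i j := by
    intro i j; rw [hM'v, hN]; rfl
  -- reduction
  have hdetpi : (N.map π).det = π N.det := (RingHom.map_det π N).symm
  let N' : GL (Fin 2) 𝔽 := Matrix.GeneralLinearGroup.mkOfDetNeZero (N.map π) (by
    rw [hdetpi]; exact (hunit.map π).ne_zero)
  have hN'1 : PGL2.mk N' = 1 := by
    rw [← hred]; exact (hredcompat s hs M' N hM's hNM hunit N' rfl).symm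
  obtain ⟨e01, e10, e00⟩ := (pgl_mk_eq_one _).mp hN'1
  change π (N 0 1) = 0 at e01
  change π (N 1 0) = 0 at e10
  change π (N 0 0) = π (N 1 1) at e00
  have hNpi : N.map π = π (N 0 0) • (1 : Matrix (Fin 2) (Fin 2) 𝔽) := by
    ext i j
    fin_cases i <;> fin_cases j <;> simp [e01, e10, e00]
  have hb : π (N 0 0) ≠ 0 := by
    intro h0
    have := (hunit.map π).ne_zero
    rw [← hdetpi, hNpi, h0] at this
    simp at this
  have hcoe : ∀ n i j, (((N ^ n) i j : ValSubring v hv) : k) = ((M' ^ n : GL (Fin 2) k) : Matrix (Fin 2) (Fin 2) k) i j := by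
    intro n i j
    have h1 : N.map (ValSubring v hv).subtype = (M' : Matrix (Fin 2) (Fin 2) k) := by
      ext i j; exact hNM i j
    have h2 := map_pow (ValSubring v hv).subtype.mapMatrix N n
    rw [RingHom.mapMatrix_apply, RingHom.mapMatrix_apply, h1] at h2
    rw [Units.val_pow_eq_pow_val, ← h2]; rfl
  have hone : ∀ n, s ^ n = 1 ↔ (N ^ n) 0 1 = 0 ∧ (N ^ n) 1 0 = 0 ∧ (N ^ n) 0 0 = (N ^ n) 1 1 := by
    intro n
    have h1 : s ^ n = PGL2.mk (M' ^ n) := by rw [← hM's]; rfl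
    rw [h1, pgl_mk_eq_one]
    simp only [← hcoe, ZeroMemClass.coe_eq_zero, Subtype.coe_inj]
  have hclaim : ∀ j m : ℕ, (m : 𝔽) ≠ 0 → s ^ (j * m) = 1 → s ^ j = 1 := by
    intro j m hm h
    rw [hone, pow_mul] at h
    rw [hone]
    refine scalar_of_pow π (N ^ j) (π (N 0 0) ^ j) (pow_ne_zero _ hb) ?_ m hm h.1 h.2.1 h.2.2
    have h2 := map_pow π.mapMatrix N j
    rw [RingHom.mapMatrix_apply, RingHom.mapMatrix_apply, hNpi] at h2
    rw [h2, smul_pow, one_pow]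
  -- finite order
  obtain ⟨n, hn, q, hq⟩ := fin_order hd hhom hrel hMdet hl
  have hsn : s ^ n = 1 := by
    have h1 : s ^ n = PGL2.mk (M ^ n) := by rw [← hMs]; rfl
    rw [h1, pgl_mk_eq_one, Units.val_pow_eq_pow_val, hq]
    simp
  have hr : 0 < orderOf s := orderOf_pos_iff.mpr (isOfFinOrder_iff_pow_eq_one.mpr ⟨n, hn, hsn⟩)
  constructor
  · intro hp0
    have hpp : p.Prime := (CharP.char_is_prime_or_zero 𝔽 p).resolve_right hp0
    obtain ⟨e, m, hm, hem⟩ := Nat.exists_eq_pow_mul_and_not_dvd hr.ne' p hpp.ne_one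
    have h1 := hclaim (p ^ e) m (by rwa [Ne, CharP.cast_eq_zero_iff 𝔽 p]) (by
      rw [← hem]; exact pow_orderOf_eq_one s)
    obtain ⟨f, -, hf⟩ := (Nat.dvd_prime_pow hpp).mp (orderOf_dvd_of_pow_eq_one h1)
    exact ⟨f, hf⟩
  · rintro rfl
    have h1 := hclaim 1 (orderOf s) (by
      rw [Ne, CharP.cast_eq_zero_iff 𝔽 0, zero_dvd_iff]; exact hr.ne') (by
      rw [one_mul]; exact pow_orderOf_eq_one s)
    rwa [pow_one] at h1
end
end

section
/- Let F be a field and n ≥ 2 an integer. Suppose φ ∈ F(z) is a rational function of degree d ≥ 2 such that Aut_φ(F) contains an element of order n. Then n divides one of d, d − 1, or d + 1. -/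
open MvPolynomial

noncomputable section

lemma nz_aux {F K : Type*} [Field F] [Field K] [Algebra F K] [Algebra.IsAlgebraic F K]
    {d : ℕ} (hd : 1 ≤ d) (Φ : Fin 2 → MvPolynomial (Fin 2) F)
    (hhom : ∀ i, (Φ i).IsHomogeneous d)
    (hrel : IsRelPrime (Φ 0) (Φ 1)) (v : Fin 2 → K) (hv : ∀ i, aeval v (Φ i) = 0) : v = 0 := by
  by_contra hne
  have hom : ∀ i, Polynomial.homogenize (aeval ![Polynomial.X, 1] (Φ i)) d = Φ i := fun i =>
    Polynomial.homogenize_eq_of_isHomogeneous (hhom i) rfl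
  have key : ∀ H : MvPolynomial (Fin 2) F, (∃ x : Fin 2 → K, aeval x H = 0) →
      ¬ ∀ i, H ∣ Φ i := by
    rintro H ⟨x, hx⟩ hH
    have := (hrel (hH 0) (hH 1)).map (aeval x : MvPolynomial (Fin 2) F →ₐ[F] K)
    rw [hx] at this
    exact not_isUnit_zero this
  by_cases h1 : v 1 = 0
  · refine key (X 1) ⟨v, by simpa using h1⟩ fun i => ?_
    have h0 : v 0 ≠ 0 := fun h0 => hne (by ext i; fin_cases i <;> assumption)
    have hi := hv i
    rw [← hom i] at hi ⊢
    set f : Polynomial F := aeval ![Polynomial.X, 1] (Φ i)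
    have hf : f.coeff d = 0 := by
      rw [Polynomial.homogenize, map_sum, Finset.sum_eq_single (d, 0)] at hi
      · simpa [aeval_monomial, h0, Finsupp.prod_fintype] using hi
      · rintro ⟨a, b⟩ hab hne
        have : b ≠ 0 := by rintro rfl; simp at hab; simp [hab] at hne
        simp [aeval_monomial, h1, this, Finsupp.prod_fintype]
      · simp
    rw [Polynomial.homogenize]
    refine Finset.dvd_sum fun kl hkl => ?_
    rcases kl with ⟨a, b⟩
    rcases Nat.eq_zero_or_pos b with rfl | hb
    · simp at hkl; subst hkl; simp [hf]
    · rw [MvPolynomial.monomial_eq]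
      refine Dvd.dvd.mul_left ?_ _
      rw [Finsupp.prod_fintype _ _ (by simp)]
      simp only [Fin.prod_univ_two]
      refine Dvd.dvd.mul_left ?_ _
      apply dvd_pow_self
      simp; omega
  · set z : K := v 0 / v 1
    have hz : IsIntegral F z := Algebra.IsIntegral.isIntegral z
    refine key (Polynomial.homogenize (minpoly F z) (minpoly F z).natDegree) ⟨![z, 1], ?_⟩ fun i => ?_
    · rw [Polynomial.aeval_homogenize_of_eq_one le_rfl _ (by simp)]; simp
    · have hi := hv i
      rcases eq_or_ne (Φ i) 0 with h0 | h0
      · simp [h0]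
      rw [← hom i] at hi ⊢
      set f : Polynomial F := aeval ![Polynomial.X, 1] (Φ i)
      have hf0 : f ≠ 0 := by
        intro h; apply h0; rw [← hom i]; change Polynomial.homogenize f d = 0; simp [h]
      have hfd : f.natDegree ≤ d := by
        have : f = aeval ![Polynomial.X, 1] (Φ i) := rfl
        rw [this, ← hom i, Polynomial.homogenize, map_sum]
        refine Polynomial.natDegree_sum_le_of_forall_le _ _ fun kl hkl => ?_
        have := Finset.HasAntidiagonal.mem_antidiagonal.1 hkl
        rw [aeval_monomial, Finsupp.prod_fintype _ _ (by simp)]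
        simp only [Fin.prod_univ_two]
        simp
        refine (Polynomial.natDegree_C_mul_X_pow_le _ _).trans (by omega)
      have hroot : Polynomial.aeval z f = 0 := by
        have h2 := Polynomial.eval_homogenize (p := f.map (algebraMap F K)) (n := d)
          (by simpa using hfd) v h1
        rw [Polynomial.homogenize_map, MvPolynomial.eval_map] at h2
        rw [aeval_def] at hi
        rw [hi] at h2
        have := (mul_eq_zero.1 h2.symm).resolve_right (pow_ne_zero _ h1)
        simpa [Polynomial.aeval_def, Polynomial.eval_map] using this
      obtain ⟨q, hq⟩ := minpoly.dvd F z hroot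
      have hq0 : q ≠ 0 := by rintro rfl; simp [hq] at hf0
      have hdeg : f.natDegree = (minpoly F z).natDegree + q.natDegree := by
        rw [hq, Polynomial.natDegree_mul (minpoly.ne_zero hz) hq0]
      have : d = (minpoly F z).natDegree + (d - (minpoly F z).natDegree) := by omega
      rw [hq, this, Polynomial.homogenize_mul _ _ le_rfl (by omega)]
      exact dvd_mul_right _ _

lemma lead_aux {F K : Type*} [Field F] [Field K] [Algebra F K] {d : ℕ}
    (p : MvPolynomial (Fin 2) F) (hp : p.IsHomogeneous d) (v w : Fin 2 → K) :
    (aeval (fun i => Polynomial.C (w i) + Polynomial.C (v i) * Polynomial.X) p).natDegree ≤ d ∧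
    (aeval (fun i => Polynomial.C (w i) + Polynomial.C (v i) * Polynomial.X) p).coeff d
      = aeval v p := by
  have hl : ∀ i, (Polynomial.C (w i) + Polynomial.C (v i) * Polynomial.X).natDegree ≤ 1 := by
    intro i; rw [add_comm]; exact Polynomial.natDegree_linear_le
  have hc : ∀ i, (Polynomial.C (w i) + Polynomial.C (v i) * Polynomial.X).coeff 1 = v i := by
    intro i; simp [Polynomial.coeff_C]
  have hpw : ∀ i (k : ℕ),
      ((Polynomial.C (w i) + Polynomial.C (v i) * Polynomial.X) ^ k).natDegree ≤ k := by
    intro i k; simpa using Polynomial.natDegree_pow_le_of_le k (hl i)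
  have hpc : ∀ i (k : ℕ),
      ((Polynomial.C (w i) + Polynomial.C (v i) * Polynomial.X) ^ k).coeff k = v i ^ k := by
    intro i k
    have := Polynomial.coeff_pow_of_natDegree_le (m := k) (hl i)
    rw [hc] at this; simpa using this
  have hs : ∀ m ∈ p.support, m 0 + m 1 = d := by
    intro m hm
    have := hp (mem_support_iff.1 hm)
    simpa [Finsupp.weight_apply, Finsupp.sum_fintype] using this
  rw [aeval_def, aeval_def, eval₂_eq', eval₂_eq']
  constructor
  · refine Polynomial.natDegree_sum_le_of_forall_le _ _ fun m hm => ?_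
    rw [IsScalarTower.algebraMap_apply F K, ← Polynomial.C_eq_algebraMap]
    refine (Polynomial.natDegree_C_mul_le _ _).trans ?_
    rw [Fin.prod_univ_two, ← hs m hm]
    exact Polynomial.natDegree_mul_le_of_le (hpw _ _) (hpw _ _)
  · rw [Polynomial.finsetSum_coeff]
    refine Finset.sum_congr rfl fun m hm => ?_
    rw [IsScalarTower.algebraMap_apply F K, ← Polynomial.C_eq_algebraMap, Polynomial.coeff_C_mul,
      Fin.prod_univ_two, Fin.prod_univ_two, ← hs m hm,
      Polynomial.coeff_mul_add_eq_of_natDegree_le (hpw _ _) (hpw _ _), hpc, hpc]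

lemma smul_aux {F S : Type*} [Field F] [CommRing S] [Algebra F S] {d : ℕ}
    (p : MvPolynomial (Fin 2) F) (hp : p.IsHomogeneous d) (a : S) (v : Fin 2 → S) :
    aeval (fun i => a * v i) p = a ^ d * aeval v p := by
  have hs : ∀ m ∈ p.support, m 0 + m 1 = d := by
    intro m hm
    have := hp (mem_support_iff.1 hm)
    simpa [Finsupp.weight_apply, Finsupp.sum_fintype] using this
  rw [aeval_def, aeval_def, eval₂_eq', eval₂_eq', Finset.mul_sum]
  refine Finset.sum_congr rfl fun m hm => ?_
  rw [Fin.prod_univ_two, Fin.prod_univ_two, ← hs m hm]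
  ring

lemma taylor_aux {K : Type*} [Field K] (f : Polynomial K) (r : K) (n j : ℕ)
    (hf : f.natDegree ≤ n + j) :
    (Polynomial.taylor r f).coeff n =
      ∑ i ∈ Finset.range (j + 1), ((n + i).choose n : K) * f.coeff (n + i) * r ^ i := by
  rw [Polynomial.taylor_coeff, Polynomial.eval_eq_sum_range' (n := j + 1)]
  · refine Finset.sum_congr rfl fun i _ => ?_
    rw [Polynomial.hasseDeriv_coeff, add_comm i n]
  · have := Polynomial.natDegree_hasseDeriv_le f n
    omega


lemma pow_ne_aux {K : Type*} [Field K] (A : Matrix (Fin 2) (Fin 2) K) (a e : K)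
    (hA : A * A = (a + e) • A - (a * e) • (1 : Matrix (Fin 2) (Fin 2) K)) (k : ℕ) :
    (a - e) • A ^ k = a ^ k • (A - e • (1 : Matrix (Fin 2) (Fin 2) K))
      - e ^ k • (A - a • (1 : Matrix (Fin 2) (Fin 2) K)) := by
  induction k with
  | zero => simp only [pow_zero]; module
  | succ k ih =>
    rw [pow_succ, ← smul_mul_assoc, ih, sub_mul, smul_mul_assoc, smul_mul_assoc, sub_mul, sub_mul,
      smul_mul_assoc, smul_mul_assoc, one_mul, hA]
    module

lemma pow_eq_aux {K : Type*} [Field K] (A : Matrix (Fin 2) (Fin 2) K) (a : K)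
    (hA : A * A = (a + a) • A - (a * a) • (1 : Matrix (Fin 2) (Fin 2) K)) (k : ℕ) :
    A ^ (k + 1) = a ^ (k + 1) • (1 : Matrix (Fin 2) (Fin 2) K) +
      (((k + 1 : ℕ) : K) * a ^ k) • (A - a • (1 : Matrix (Fin 2) (Fin 2) K)) := by
  induction k with
  | zero => simp
  | succ k ih =>
    rw [pow_succ, ih, add_mul, smul_mul_assoc, smul_mul_assoc, sub_mul,
      smul_mul_assoc, one_mul, hA]
    push_cast
    module

lemma eig_aux {K : Type*} [Field K] (A : Matrix (Fin 2) (Fin 2) K) (a e μ : K)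
    (hA : A * A = (a + e) • A - (a * e) • (1 : Matrix (Fin 2) (Fin 2) K)) (y : Fin 2 → K)
    (hy : y ≠ 0) (h : A.mulVec y = μ • y) : μ = a ∨ μ = e := by
  have h2 : (A * A).mulVec y = (μ * μ) • y := by
    rw [← Matrix.mulVec_mulVec, h, Matrix.mulVec_smul, h, smul_smul]
  rw [hA, Matrix.sub_mulVec, Matrix.smul_mulVec, Matrix.smul_mulVec, h, Matrix.one_mulVec] at h2
  have h3 : ((μ - a) * (μ - e)) • y = 0 := by
    have : ((μ - a) * (μ - e)) • y = (μ * μ) • y - ((a + e) • μ • y - (a * e) • y) := by module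
    rw [this, h2, sub_self]
  rcases mul_eq_zero.1 ((smul_eq_zero.1 h3).resolve_right hy) with h | h
  · exact Or.inl (sub_eq_zero.1 h)
  · exact Or.inr (sub_eq_zero.1 h)

lemma core_aux {F K : Type*} [Field F] [Field K] [Algebra F K] [IsAlgClosed K]
    {d : ℕ} (hd : 2 ≤ d) (Φ : Fin 2 → MvPolynomial (Fin 2) F)
    (hhom : ∀ i, (Φ i).IsHomogeneous d)
    (hnz : ∀ v : Fin 2 → K, (∀ i, aeval v (Φ i) = 0) → v = 0)
    (A : Matrix (Fin 2) (Fin 2) K) (hdet : A.det ≠ 0) (c : K)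
    (hK : ∀ x : Fin 2 → K, A.mulVec (fun i => aeval x (Φ i)) =
      c • (fun i => aeval (A.mulVec x) (Φ i)))
    (hP : ∀ (x : Fin 2 → Polynomial K) (i : Fin 2),
      ∑ j, Polynomial.C (A i j) * aeval x (Φ j) =
        Polynomial.C c * aeval (fun i => ∑ j, Polynomial.C (A i j) * x j) (Φ i)) :
    ∃ (k : ℕ) (z : K), (k = d ∨ k = d - 1 ∨ k = d + 1) ∧
      A ^ k = z • (1 : Matrix (Fin 2) (Fin 2) K) := by
  -- eigenvalues
  obtain ⟨a, ha⟩ : ∃ a : K, a * a - A.trace * a + A.det = 0 := by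
    obtain ⟨a, ha⟩ := IsAlgClosed.exists_root A.charpoly (by
      rw [Matrix.charpoly_degree_eq_dim]; simp)
    refine ⟨a, ?_⟩
    rw [Polynomial.IsRoot, Matrix.charpoly_fin_two] at ha
    simp at ha
    linear_combination ha
  obtain ⟨e, he⟩ : ∃ e, e = A.trace - a := ⟨_, rfl⟩
  have hae : a * e = A.det := by rw [he]; linear_combination -ha
  have htr : A.trace = a + e := by rw [he]; ring
  have hA : A * A = (a + e) • A - (a * e) • (1 : Matrix (Fin 2) (Fin 2) K) := by
    rw [hae, ← htr]
    ext i j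
    fin_cases i <;> fin_cases j <;>
      simp [Matrix.mul_apply, Fin.sum_univ_two, Matrix.trace_fin_two, Matrix.det_fin_two] <;> ring
  have ha0 : a ≠ 0 := by rintro rfl; simp at hae; exact hdet hae.symm
  have he0 : e ≠ 0 := by rintro rfl; simp at hae; exact hdet hae.symm
  have hΦ : ∀ (v : Fin 2 → K) (b : K), v ≠ 0 → A.mulVec v = b • v →
      c * b ^ d = a ∨ c * b ^ d = e := by
    intro v b hv hb
    refine eig_aux A a e _ hA (fun i => aeval v (Φ i)) (fun h => hv (hnz v (congrFun h))) ?_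
    rw [hK, hb]
    ext i
    have := smul_aux (Φ i) (hhom i) b v
    simp only [Pi.smul_apply, smul_eq_mul]
    rw [show b • v = fun i => b * v i from rfl, this]; ring
  have hev : ∀ b, b * b - A.trace * b + A.det = 0 → ∃ v : Fin 2 → K, v ≠ 0 ∧ A.mulVec v = b • v := by
    intro b hb
    have : (A - b • (1 : Matrix (Fin 2) (Fin 2) K)).det = 0 := by
      rw [← hb]
      simp [Matrix.trace_fin_two, Matrix.det_fin_two]; ring
    obtain ⟨v, hv, h⟩ := Matrix.exists_mulVec_eq_zero_iff.2 this
    refine ⟨v, hv, ?_⟩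
    rw [Matrix.sub_mulVec, Matrix.smul_mulVec, Matrix.one_mulVec] at h
    exact sub_eq_zero.1 h
  by_cases hne : a = e
  · subst hne
    set N := A - a • (1 : Matrix (Fin 2) (Fin 2) K) with hN
    have hAN : A = N + a • (1 : Matrix (Fin 2) (Fin 2) K) := by rw [hN]; abel
    have hNN : N * N = 0 := by
      rw [hN]
      simp only [sub_mul, mul_sub, smul_mul_assoc, mul_smul_comm, one_mul, mul_one, hA]
      module
    have hk : ∀ k : ℕ, 1 ≤ k → ((k : K) = 0 ∨ N = 0) →
        A ^ k = (a ^ k) • (1 : Matrix (Fin 2) (Fin 2) K) := by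
      intro k hk h
      obtain ⟨k, rfl⟩ : ∃ m, k = m + 1 := ⟨k - 1, by omega⟩
      rw [pow_eq_aux A a hA]
      rcases h with h | h
      · rw [h]; simp
      · rw [← hN, h]; simp
    by_cases hN0 : N = 0
    · exact ⟨d, _, Or.inl rfl, hk d (by omega) (Or.inr hN0)⟩
    obtain ⟨w, hw⟩ : ∃ w, N.mulVec w ≠ 0 := by
      by_contra! h
      exact hN0 (Matrix.mulVec_injective (by ext1 v; simp [h]))
    set v := N.mulVec w with hv
    have hNv : N.mulVec v = 0 := by rw [hv, Matrix.mulVec_mulVec, hNN, Matrix.zero_mulVec]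
    have hAv : A.mulVec v = a • v := by
      rw [hAN, Matrix.add_mulVec, hNv, Matrix.smul_mulVec, Matrix.one_mulVec, zero_add]
    have hAw : A.mulVec w = a • w + v := by
      rw [hAN, Matrix.add_mulVec, ← hv, Matrix.smul_mulVec, Matrix.one_mulVec, add_comm]
    have hca : c * a ^ d = a := by simpa using hΦ v a hw hAv
    let x : Fin 2 → Polynomial K := fun i =>
      Polynomial.C (w i) + Polynomial.C (v i) * Polynomial.X
    let u : Fin 2 → Polynomial K := fun i => aeval x (Φ i)
    have hdeg : ∀ i, (u i).natDegree ≤ d := fun i => (lead_aux (Φ i) (hhom i) v w).1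
    have hlead : ∀ i, (u i).coeff d = aeval v (Φ i) := fun i =>
      (lead_aux (Φ i) (hhom i) v w).2
    have hu : ∀ i, ∑ j, Polynomial.C (A i j) * u j =
        Polynomial.C a * Polynomial.taylor a⁻¹ (u i) := by
      intro i
      have h1 : (fun i => ∑ j, Polynomial.C (A i j) * x j) =
          fun i => Polynomial.C a * Polynomial.taylor a⁻¹ (x i) := by
        ext1 i
        have hv' := congrFun hAv i
        have hw' := congrFun hAw i
        simp only [Matrix.mulVec, dotProduct, Fin.sum_univ_two, Pi.smul_apply, smul_eq_mul,
          Pi.add_apply] at hv' hw'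
        simp only [x, Fin.sum_univ_two, map_add, Polynomial.taylor_mul, Polynomial.taylor_C,
          Polynomial.taylor_X]
        have hv'' := congrArg Polynomial.C hv'
        have hw'' := congrArg Polynomial.C hw'
        have hinv : Polynomial.C a * Polynomial.C a⁻¹ = 1 := by
          rw [← Polynomial.C_mul, mul_inv_cancel₀ ha0, Polynomial.C_1]
        simp only [map_add, map_mul] at hv'' hw''
        linear_combination Polynomial.X * hv'' + hw'' - Polynomial.C (v i) * hinv
      rw [hP x i, h1, smul_aux (Φ i) (hhom i), ← mul_assoc, ← Polynomial.C_pow,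
        ← Polynomial.C_mul, hca]
      congr 1
      have := MvPolynomial.comp_aeval_apply x
        ((Polynomial.taylorAlgHom a⁻¹ : Polynomial K →ₐ[K] Polynomial K).restrictScalars F) (Φ i)
      exact this.symm
    have hcoef : ∀ n i, ∑ j, A i j * (u j).coeff n =
        a * (Polynomial.taylor a⁻¹ (u i)).coeff n := by
      intro n i
      have := congrArg (fun p => Polynomial.coeff p n) (hu i)
      simpa [Fin.sum_univ_two] using this
    obtain ⟨m, rfl⟩ : ∃ m, d = m + 2 := ⟨d - 2, by omega⟩
    let U : ℕ → Fin 2 → K := fun n i => (u i).coeff n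
    have e2 : N.mulVec (U (m + 2)) = 0 := by
      have : A.mulVec (U (m + 2)) = a • U (m + 2) := by
        ext i
        have h := hcoef (m + 2) i
        rw [taylor_aux (u i) a⁻¹ (m + 2) 0 (hdeg i)] at h
        simp at h
        simpa [Matrix.mulVec, dotProduct, U] using h
      rw [hN, Matrix.sub_mulVec, this, Matrix.smul_mulVec, Matrix.one_mulVec, sub_self]
    have e1 : N.mulVec (U (m + 1)) = ((m + 2 : ℕ) : K) • U (m + 2) := by
      have : A.mulVec (U (m + 1)) = a • U (m + 1) + ((m + 2 : ℕ) : K) • U (m + 2) := by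
        ext i
        have h := hcoef (m + 1) i
        rw [taylor_aux (u i) a⁻¹ (m + 1) 1 (hdeg i)] at h
        rw [Finset.sum_range_succ, Finset.sum_range_one] at h
        have hc : (m + 1 + 1).choose (m + 1) = m + 2 := Nat.choose_succ_self_right (m + 1)
        rw [hc] at h
        simp only [add_zero, Nat.choose_self, Nat.cast_one, one_mul, pow_zero, mul_one, pow_one] at h
        have h' : A.mulVec (U (m + 1)) i = _ := h
        rw [h']
        simp only [U, Pi.add_apply, Pi.smul_apply, smul_eq_mul]
        field_simp
      rw [hN, Matrix.sub_mulVec, this, Matrix.smul_mulVec, Matrix.one_mulVec, add_sub_cancel_left]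
    obtain ⟨t, e0⟩ : ∃ t : K, N.mulVec (U m) = ((m + 1 : ℕ) : K) • U (m + 1) + t • U (m + 2) := by
      refine ⟨((m + 2).choose m : K) * a⁻¹, ?_⟩
      have : A.mulVec (U m) = a • U m + (((m + 1 : ℕ) : K) • U (m + 1) +
          (((m + 2).choose m : K) * a⁻¹) • U (m + 2)) := by
        ext i
        have h := hcoef m i
        rw [taylor_aux (u i) a⁻¹ m 2 (hdeg i)] at h
        rw [Finset.sum_range_succ, Finset.sum_range_succ, Finset.sum_range_one] at h
        have hc : (m + 1).choose m = m + 1 := Nat.choose_succ_self_right m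
        rw [hc] at h
        simp only [add_zero, Nat.choose_self, Nat.cast_one, one_mul, pow_zero, mul_one, pow_one] at h
        have h' : A.mulVec (U m) i = _ := h
        rw [h']
        simp only [U, Pi.add_apply, Pi.smul_apply, smul_eq_mul]
        field_simp
        ring
      rw [hN, Matrix.sub_mulVec, this, Matrix.smul_mulVec, Matrix.one_mulVec, add_sub_cancel_left]
    have hU : U (m + 2) ≠ 0 := by
      intro h
      exact hw (hnz v fun i => by rw [← hlead i]; exact congrFun h i)
    have hfin : (((m + 1 : ℕ) : K) * ((m + 2 : ℕ) : K)) • U (m + 2) = 0 := by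
      have : N.mulVec (N.mulVec (U m)) = 0 := by
        rw [Matrix.mulVec_mulVec, hNN, Matrix.zero_mulVec]
      rw [e0, Matrix.mulVec_add, Matrix.mulVec_smul, Matrix.mulVec_smul, e1, e2, smul_zero,
        add_zero, smul_smul] at this
      exact this
    rcases mul_eq_zero.1 ((smul_eq_zero.1 hfin).resolve_right hU) with h | h
    · exact ⟨m + 1, _, Or.inr (Or.inl rfl), hk _ (by omega) (Or.inl h)⟩
    · exact ⟨m + 2, _, Or.inl rfl, hk _ (by omega) (Or.inl h)⟩
  · have hk : ∀ k : ℕ, a ^ k = e ^ k → A ^ k = (a ^ k) • (1 : Matrix (Fin 2) (Fin 2) K) := by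
      intro k hk
      have h := pow_ne_aux A a e hA k
      have h0 : a - e ≠ 0 := sub_ne_zero.2 hne
      apply smul_right_injective _ h0
      simp only
      rw [h, ← hk]
      module
    obtain ⟨v, hv, hv'⟩ := hev a ha
    obtain ⟨w, hw, hw'⟩ := hev e (by rw [htr, ← hae]; ring)
    have hc0 : c ≠ 0 := by
      rintro rfl
      rcases hΦ v a hv hv' with h | h <;> simp at h
      · exact ha0 h.symm
      · exact he0 h.symm
    obtain ⟨m, rfl⟩ : ∃ m, d = m + 1 := ⟨d - 1, by omega⟩
    rcases hΦ v a hv hv' with h1 | h1 <;> rcases hΦ w e hw hw' with h2 | h2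
    · exact ⟨m + 1, _, Or.inl rfl, hk _ (mul_left_cancel₀ hc0 (h1.trans h2.symm))⟩
    · refine ⟨m, _, Or.inr (Or.inl rfl), hk _ ?_⟩
      apply mul_left_cancel₀ hc0
      have h3 : c * a ^ m = 1 := mul_right_cancel₀ ha0 (by rw [one_mul, mul_assoc, ← pow_succ, h1])
      have h4 : c * e ^ m = 1 := mul_right_cancel₀ he0 (by rw [one_mul, mul_assoc, ← pow_succ, h2])
      rw [h3, h4]
    · refine ⟨m + 1 + 1, _, Or.inr (Or.inr rfl), hk _ ?_⟩
      apply mul_left_cancel₀ hc0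
      rw [pow_succ a (m + 1), pow_succ e (m + 1), ← mul_assoc, ← mul_assoc, h1, h2, mul_comm]
    · exact ⟨m + 1, _, Or.inl rfl, hk _ (mul_left_cancel₀ hc0 (h1.trans h2.symm))⟩

/-- if `Aut_φ(F)` contains an element of order `n ≥ 2`, then `n`
divides one of `d`, `d - 1`, `d + 1`. -/
theorem order_of_automorphism_divides
    {F : Type*} [Field F] (n d : ℕ) (hn : 2 ≤ n) (hd : 2 ≤ d)
    (Φ : Fin 2 → MvPolynomial (Fin 2) F)
    (hhom : ∀ i, (Φ i).IsHomogeneous d)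
    (hrel : IsRelPrime (Φ 0) (Φ 1))
    (s : PGL2 F) (hs : s ∈ AutSet Φ) (hord : orderOf s = n) :
    n ∣ d ∨ n ∣ d - 1 ∨ n ∣ d + 1 := by
  obtain ⟨M, rfl, c, hc⟩ := hs
  let K := AlgebraicClosure F
  let A : Matrix (Fin 2) (Fin 2) K := (M : Matrix (Fin 2) (Fin 2) F).map (algebraMap F K)
  have hgen : ∀ (S : Type _) [CommRing S] [Algebra F S] (x : Fin 2 → S) (i : Fin 2),
      ∑ j, algebraMap F S ((M : Matrix (Fin 2) (Fin 2) F) i j) * aeval x (Φ j) =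
        algebraMap F S c *
          aeval (fun i => ∑ j, algebraMap F S ((M : Matrix (Fin 2) (Fin 2) F) i j) * x j)
            (Φ i) := by
    intro S _ _ x i
    have h := congrArg (aeval x) (hc i)
    rw [map_mul, aeval_bind₁, aeval_bind₁] at h
    simpa [linForms, Fin.sum_univ_two] using h
  have hdet : A.det ≠ 0 := by
    have h1 : A.det = algebraMap F K (M : Matrix (Fin 2) (Fin 2) F).det :=
      ((algebraMap F K).map_det _).symm
    rw [h1]
    have : IsUnit (M : Matrix (Fin 2) (Fin 2) F).det :=
      (Matrix.isUnit_iff_isUnit_det _).1 M.isUnit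
    exact (this.map (algebraMap F K)).ne_zero
  obtain ⟨k, z, hk, hz⟩ := core_aux (K := K) hd Φ hhom
    (nz_aux (by omega) Φ hhom hrel) A hdet (algebraMap F K c)
    (fun x => by
      ext i
      exact hgen K x i)
    (fun x i => by
      have := hgen (Polynomial K) x i
      simpa only [A, Matrix.map_apply, Polynomial.C_eq_algebraMap,
        ← IsScalarTower.algebraMap_apply F K (Polynomial K)] using this)
  have hdvd : n ∣ k := by
    rw [← hord]
    apply orderOf_dvd_of_pow_eq_one
    change (QuotientGroup.mk M : PGL2 F) ^ k = 1
    rw [← QuotientGroup.mk_pow, QuotientGroup.eq_one_iff,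
      Matrix.GeneralLinearGroup.mem_center_iff_val_mem_range_scalar]
    have hz' : ((M : Matrix (Fin 2) (Fin 2) F) ^ k).map (algebraMap F K) =
        z • (1 : Matrix (Fin 2) (Fin 2) K) := by
      rw [← hz]; exact Matrix.map_pow _ _ _
    have hij := fun i j => congrFun (congrFun hz' i) j
    have h00 := hij 0 0
    have h01 := hij 0 1
    have h10 := hij 1 0
    have h11 := hij 1 1
    simp only [Matrix.map_apply, Matrix.smul_apply, Matrix.one_apply] at h00 h01 h10 h11
    refine ⟨((M : Matrix (Fin 2) (Fin 2) F) ^ k) 0 0, ?_⟩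
    have hinj := (algebraMap F K).injective
    ext i j
    apply hinj
    fin_cases i <;> fin_cases j <;> simp [h00, h01, h10, h11]
  rcases hk with rfl | rfl | rfl
  · exact Or.inl hdvd
  · exact Or.inr (Or.inl hdvd)
  · exact Or.inr (Or.inr hdvd)
end
end

section
/- Let K be a number field and let φ ∈ K(z) be a rational function of degree d ≥ 2. Define S₀ to be the set of rational primes S₀ = {2} ∪ {p odd prime : (p − 1)/2 divides [K : ℚ] and p divides d(d² − 1)}, and let S be the finite set of places of K consisting of the places of bad reduction for φ together with the places dividing a prime in S₀. Then for every finite place v of K outside S, the reduction map red_v : Aut_φ(K) → Aut_φ(𝔽_v) is a well-defined injective group homomorphism. -/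
open MvPolynomial

noncomputable section

open NumberField IsDedekindDomain

/-- No common zeros over extension fields. -/
lemma scale_form {R L : Type*} [CommRing R] [CommRing L] [Algebra R L] {F : MvPolynomial (Fin 2) R}
    {d : ℕ} (hF : F.IsHomogeneous d) (t : L) (x : Fin 2 → L) :
    aeval (t • x) F = t ^ d * aeval x F := by
  rw [aeval_def, aeval_def, eval₂_eq', eval₂_eq', Finset.mul_sum]
  refine Finset.sum_congr rfl fun m hm => ?_
  have := hF (mem_support_iff.mp hm)
  rw [Finsupp.weight_apply, Finsupp.sum_fintype _ _ (by simp)] at this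
  simp only [Fin.sum_univ_two, Pi.one_apply, smul_eq_mul, mul_one] at this
  simp only [Fin.prod_univ_two, Pi.smul_apply, smul_eq_mul, ← this]
  ring

lemma hom_dvd {K : Type*} [Field K] {F : MvPolynomial (Fin 2) K} {d : ℕ}
    (hF : F.IsHomogeneous d) (h : Polynomial K)
    (hd : h ∣ aeval ![Polynomial.X, 1] F) : h.homogenize h.natDegree ∣ F := by
  by_cases h0 : F = 0
  · simp [h0]
  obtain ⟨q, hq⟩ := hd
  have e := Polynomial.homogenize_eq_of_isHomogeneous hF rfl
  have hne : aeval ![Polynomial.X, (1 : Polynomial K)] F ≠ 0 := by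
    intro h'
    rw [h'] at e
    simp at e
    exact h0 e.symm
  have hdeg : (aeval ![Polynomial.X, (1 : Polynomial K)] F).natDegree ≤ d := by
    rw [F.as_sum]
    simp only [map_sum, aeval_monomial]
    refine Polynomial.natDegree_sum_le_of_forall_le _ _ fun m hm => ?_
    have := hF (mem_support_iff.mp hm)
    rw [Finsupp.weight_apply, Finsupp.sum_fintype _ _ (by simp)] at this
    simp only [Fin.sum_univ_two, Pi.one_apply, smul_eq_mul, mul_one] at this
    simp only [Finsupp.prod_fintype, pow_zero, implies_true, Fin.prod_univ_two,
      Matrix.cons_val_zero, Matrix.cons_val_one, one_pow, mul_one]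
    refine (Polynomial.natDegree_C_mul_X_pow_le _ _).trans (by omega)
  rw [hq] at hne hdeg e
  have h1 : h ≠ 0 := left_ne_zero_of_mul hne
  have h2 : q ≠ 0 := right_ne_zero_of_mul hne
  rw [Polynomial.natDegree_mul h1 h2] at hdeg
  have := Polynomial.homogenize_mul h q (m := h.natDegree) (n := d - h.natDegree) le_rfl (by omega)
  rw [Nat.add_sub_of_le (by omega), e] at this
  exact ⟨_, this⟩

lemma no_common_zero {K L : Type*} [Field K] [Field L] [Algebra K L]
    {F G : MvPolynomial (Fin 2) K} {d : ℕ} (hF : F.IsHomogeneous d) (hG : G.IsHomogeneous d)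
    (hrel : IsRelPrime F G) (w : Fin 2 → L) (hw : w ≠ 0)
    (h0 : aeval w F = 0) (h1 : aeval w G = 0) : False := by
  by_cases hw1 : w 1 = 0
  · have hw0 : w 0 ≠ 0 := by
      intro h; apply hw; ext i; fin_cases i <;> simp [*]
    have key : ∀ P : MvPolynomial (Fin 2) K, P.IsHomogeneous d → aeval w P = 0 → X 1 ∣ P := by
      intro P hP hz
      rw [← Ideal.mem_span_singleton, ← Set.image_singleton, mem_ideal_span_X_image]
      intro m hm
      refine ⟨1, rfl, fun hm1 => ?_⟩
      have hdeg : ∀ m' ∈ P.support, m' 0 + m' 1 = d := by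
        intro m' hm'
        have := hP (mem_support_iff.mp hm')
        rw [Finsupp.weight_apply, Finsupp.sum_fintype _ _ (by simp)] at this
        simpa only [Fin.sum_univ_two, Pi.one_apply, smul_eq_mul, mul_one] using this
      rw [aeval_def, eval₂_eq', Finset.sum_eq_single m] at hz
      · have hc := mem_support_iff.mp hm
        simp [Fin.prod_univ_two, hm1, hw0] at hz
        exact hc hz
      · intro b hb hbm
        have : b 1 ≠ 0 := by
          intro hb1
          apply hbm
          have := hdeg m hm
          have := hdeg b hb
          ext i; fin_cases i <;> simp <;> omega
        simp [Fin.prod_univ_two, hw1, this]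
      · intro h; exact absurd hm h
    have := hrel (key F hF h0) (key G hG h1)
    have hu := this.map (aeval (![1, 0] : Fin 2 → K))
    simp at hu
  · have hcop : IsCoprime (aeval ![Polynomial.X, (1 : Polynomial K)] F)
        (aeval ![Polynomial.X, (1 : Polynomial K)] G) := by
      rw [← isRelPrime_iff_isCoprime]
      intro h hf hg
      have := (hrel (hom_dvd hF h hf) (hom_dvd hG h hg)).map
        (aeval ![Polynomial.X, (1 : Polynomial K)])
      simpa using this
    have key : ∀ P : MvPolynomial (Fin 2) K, P.IsHomogeneous d → aeval w P = 0 →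
        Polynomial.aeval (w 0 / w 1) (aeval ![Polynomial.X, (1 : Polynomial K)] P) = 0 := by
      intro P hP hz
      have h2 : Polynomial.aeval (w 0 / w 1) (aeval ![Polynomial.X, (1 : Polynomial K)] P) =
          aeval ((w 1)⁻¹ • w) P := by
        rw [← AlgHom.comp_apply, comp_aeval]
        congr 2
        ext i; fin_cases i
        · simp [div_eq_inv_mul]
        · simp [hw1]
      rw [h2, scale_form hP, hz, mul_zero]
    obtain ⟨a, b, hab⟩ := hcop
    have := congrArg (Polynomial.aeval (w 0 / w 1)) hab
    simp [key F hF h0, key G hG h1] at this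
/-- Evaluation of a pair of forms. -/
def ev {R L : Type*} [CommRing R] [CommRing L] [Algebra R L]
    (A : Fin 2 → MvPolynomial (Fin 2) R) (x : Fin 2 → L) : Fin 2 → L := fun i => aeval x (A i)

lemma ev_smul {R L : Type*} [CommRing R] [CommRing L] [Algebra R L]
    {A : Fin 2 → MvPolynomial (Fin 2) R} {d : ℕ} (hA : ∀ i, (A i).IsHomogeneous d)
    (t : L) (x : Fin 2 → L) : ev A (t • x) = t ^ d • ev A x := by
  ext i
  exact scale_form (hA i) t x

lemma eig_root_s6 {L : Type*} [Field L] {N : Matrix (Fin 2) (Fin 2) L} {l m t : L}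
    (htr : l + m = N 0 0 + N 1 1) (hdet : l * m = N 0 0 * N 1 1 - N 0 1 * N 1 0)
    {z : Fin 2 → L} (hz : z ≠ 0) (h : N.mulVec z = t • z) : t = l ∨ t = m := by
  have h0 := congrFun h 0
  have h1 := congrFun h 1
  simp only [Matrix.mulVec, dotProduct, Fin.sum_univ_two, Pi.smul_apply, smul_eq_mul] at h0 h1
  have key : (t - l) * (t - m) = 0 := by
    have e : (t - l) * (t - m) = t ^ 2 - (N 0 0 + N 1 1) * t +
        (N 0 0 * N 1 1 - N 0 1 * N 1 0) := by
      rw [← htr, ← hdet]; ring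
    rw [e]
    by_cases hz0 : z 0 = 0
    · have hz1 : z 1 ≠ 0 := by
        intro h; apply hz; ext i; fin_cases i <;> simp [*]
      apply mul_right_cancel₀ hz1
      linear_combination (N 0 0 - t) * h1 - N 1 0 * h0
    · apply mul_right_cancel₀ hz0
      linear_combination (N 1 1 - t) * h0 - N 0 1 * h1
  rcases mul_eq_zero.mp key with h | h
  · left; exact sub_eq_zero.mp h
  · right; exact sub_eq_zero.mp h

lemma eig_exists_s6 {L : Type*} [Field L] {N : Matrix (Fin 2) (Fin 2) L} {l m : L}
    (htr : l + m = N 0 0 + N 1 1) (hdet : l * m = N 0 0 * N 1 1 - N 0 1 * N 1 0) :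
    ∃ w : Fin 2 → L, w ≠ 0 ∧ N.mulVec w = l • w := by
  have h : (N - Matrix.scalar (Fin 2) l).det = 0 := by
    rw [Matrix.det_fin_two]
    simp
    linear_combination l * htr - hdet
  obtain ⟨w, hw, hw2⟩ := Matrix.exists_mulVec_eq_zero_iff.mpr h
  refine ⟨w, hw, ?_⟩
  rw [Matrix.sub_mulVec, sub_eq_zero] at hw2
  rw [hw2]
  ext i; fin_cases i <;> simp [Matrix.mulVec, dotProduct]

lemma unip {K L : Type*} [Field K] [Field L] [Algebra K L] [CharZero L]
    {A : Fin 2 → MvPolynomial (Fin 2) K} {d : ℕ} (hd : 2 ≤ d) (hA : ∀ i, (A i).IsHomogeneous d)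
    (hnz : ∀ x : Fin 2 → L, x ≠ 0 → ev A x ≠ 0)
    (U : Matrix (Fin 2) (Fin 2) L) (hU : ∀ x, U.mulVec (ev A x) = ev A (U.mulVec x))
    (hE : (U - 1) * (U - 1) = 0) : U = 1 := by
  by_contra hne
  set E := U - 1 with hEdef
  have hE0 : E ≠ 0 := fun h => hne (sub_eq_zero.mp h)
  have hUE : ∀ x, U.mulVec x = x + E.mulVec x := by
    intro x; rw [hEdef, Matrix.sub_mulVec, Matrix.one_mulVec]; abel
  have hEE : ∀ x, E.mulVec (E.mulVec x) = 0 := by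
    intro x; rw [Matrix.mulVec_mulVec, hE, Matrix.zero_mulVec]
  obtain ⟨y, hy⟩ : ∃ y, E.mulVec y ≠ 0 := by
    by_contra! h
    exact hE0 (Matrix.ext_of_mulVec_single fun i => by rw [h, Matrix.zero_mulVec])
  set w := E.mulVec y with hw
  have step : ∀ n : ℕ, ev A (y + (n : L) • w) = ev A y + (n : L) • E.mulVec (ev A y) := by
    intro n
    induction n with
    | zero => simp
    | succ n ih =>
      have h1 : U.mulVec (y + (n : L) • w) = y + ((n + 1 : ℕ) : L) • w := by
        rw [hUE, Matrix.mulVec_add, Matrix.mulVec_smul, hEE, ← hw]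
        push_cast
        rw [add_smul, one_smul, smul_zero]; abel
      rw [← h1, ← hU, ih, hUE, Matrix.mulVec_add, Matrix.mulVec_smul, hEE]
      push_cast
      rw [add_smul, one_smul, smul_zero]; abel
  apply hnz w hy
  ext i
  let Q : Polynomial L := aeval (fun j => Polynomial.C (w j) + Polynomial.X * Polynomial.C (y j)) (A i)
  have hQ : ∀ s : L, Q.eval s = ev A (w + s • y) i := by
    intro s
    change (Polynomial.aeval s : Polynomial L →ₐ[L] L).restrictScalars K _ = _
    simp only [Q, ev]
    rw [← AlgHom.comp_apply, comp_aeval]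
    congr 2
    ext j
    simp
    ring
  have hQeq : Q = Polynomial.C (ev A y i) * Polynomial.X ^ d +
      Polynomial.C (E.mulVec (ev A y) i) * Polynomial.X ^ (d - 1) := by
    refine Polynomial.eq_of_infinite_eval_eq _ _ (Set.Infinite.mono
      (s := Set.range (fun n : ℕ => ((n : L) + 1)⁻¹)) ?_ (Set.infinite_range_of_injective ?_))
    · rintro _ ⟨n, rfl⟩
      have hn : ((n : L) + 1) ≠ 0 := by exact_mod_cast Nat.succ_ne_zero n
      have hs := step (n + 1)
      push_cast at hs
      have e : w + ((n : L) + 1)⁻¹ • y = ((n : L) + 1)⁻¹ • (y + ((n : L) + 1) • w) := by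
        rw [smul_add, smul_smul, inv_mul_cancel₀ hn, one_smul, add_comm]
      show Polynomial.eval _ Q = Polynomial.eval _ _
      rw [hQ, e, ev_smul hA, hs]
      obtain ⟨e, rfl⟩ : ∃ e, d = e + 1 := ⟨d - 1, by omega⟩
      generalize E.mulVec (ev A y) = z
      simp
      field_simp
      ring
    · intro a b hab
      simpa using hab
  have h0 := hQ 0
  rw [hQeq] at h0
  simp [show d ≠ 0 by omega, show d - 1 ≠ 0 by omega] at h0
  simpa using h0.symm

lemma eig_main {K L : Type*} [Field K] [Field L] [Algebra K L] [CharZero L]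
    {A : Fin 2 → MvPolynomial (Fin 2) K} {d : ℕ} (hd : 2 ≤ d) (hA : ∀ i, (A i).IsHomogeneous d)
    (hnz : ∀ x : Fin 2 → L, x ≠ 0 → ev A x ≠ 0)
    (N : Matrix (Fin 2) (Fin 2) L) (c l m : L)
    (hN : ∀ x, N.mulVec (ev A x) = c • ev A (N.mulVec x))
    (htr : l + m = N 0 0 + N 1 1) (hdet : l * m = N 0 0 * N 1 1 - N 0 1 * N 1 0)
    (hlm : l * m ≠ 0) (hns : ¬ (N 0 1 = 0 ∧ N 1 0 = 0 ∧ N 0 0 = N 1 1)) :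
    l ≠ m ∧ ∃ n : ℕ, (n = d - 1 ∨ n = d ∨ n = d + 1) ∧ l ^ n = m ^ n := by
  have hl : l ≠ 0 := left_ne_zero_of_mul hlm
  have hm : m ≠ 0 := right_ne_zero_of_mul hlm
  have gen : ∀ t, (∃ w : Fin 2 → L, w ≠ 0 ∧ N.mulVec w = t • w) →
      c * t ^ d = l ∨ c * t ^ d = m := by
    rintro t ⟨w, hw, hw2⟩
    refine eig_root_s6 htr hdet (hnz w hw) ?_
    rw [hN, hw2, ev_smul hA, smul_smul]
  have h1 := gen l (eig_exists_s6 htr hdet)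
  have h2 := gen m (eig_exists_s6 (by rw [add_comm]; exact htr) (by rw [mul_comm]; exact hdet))
  have hc : c ≠ 0 := by
    rintro rfl
    rcases h1 with h | h <;> simp at h
    · exact hl h.symm
    · exact hm h.symm
  refine ⟨?_, ?_⟩
  · rintro rfl
    have hcl : c * l ^ d = l := by tauto
    have hU : (l⁻¹ • N) = 1 := by
      refine unip hd hA hnz _ ?_ ?_
      · intro x
        rw [Matrix.smul_mulVec, hN, Matrix.smul_mulVec, ev_smul hA, smul_smul]
        congr 1
        apply mul_right_cancel₀ (pow_ne_zero d hl)
        rw [mul_assoc, hcl, inv_mul_cancel₀ hl, ← mul_pow, inv_mul_cancel₀ hl, one_pow]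
      · ext i j
        have e2 : N 0 1 * N 1 0 = N 0 0 * N 1 1 - l * l := by linear_combination hdet
        have e1 : N 1 1 = 2 * l - N 0 0 := by linear_combination - htr
        rw [e1] at e2
        fin_cases i <;> fin_cases j <;>
          simp [Matrix.mul_apply, Fin.sum_univ_two, Matrix.sub_apply] <;> field_simp <;>
          first
          | linear_combination e2
          | (rw [e1]; linear_combination e2)
          | (rw [e1]; ring)
    have hN1 : N = l • (1 : Matrix (Fin 2) (Fin 2) L) := by
      rw [← hU, smul_smul, mul_inv_cancel₀ hl, one_smul]
    apply hns
    rw [hN1]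
    simp
  · rcases h1 with h1 | h1 <;> rcases h2 with h2 | h2
    · exact ⟨d, by simp, mul_left_cancel₀ hc (h1.trans h2.symm)⟩
    · refine ⟨d - 1, by simp, ?_⟩
      obtain ⟨e, rfl⟩ : ∃ e, d = e + 1 := ⟨d - 1, by omega⟩
      simp only [Nat.add_sub_cancel]
      apply mul_left_cancel₀ hc
      apply mul_left_cancel₀ hlm
      linear_combination m * h1 - l * h2
    · refine ⟨d + 1, by simp, ?_⟩
      apply mul_left_cancel₀ hc
      linear_combination l * h1 - m * h2
    · exact ⟨d, by simp, mul_left_cancel₀ hc (h1.trans h2.symm)⟩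
lemma arith_main {K : Type*} [Field K] [NumberField K] (v : HeightOneSpectrum (𝓞 K))
    (T D : 𝓞 K) (l m : AlgebraicClosure K)
    (htr : l + m = algebraMap K _ (algebraMap (𝓞 K) K T))
    (hdet : l * m = algebraMap K _ (algebraMap (𝓞 K) K D))
    (hD : D ∉ v.asIdeal) (hdisc : T ^ 2 - 4 * D ∈ v.asIdeal)
    (hlm : l ≠ m) (n : ℕ) (hn : 0 < n) (hpow : l ^ n = m ^ n) :
    (ringChar (𝓞 K ⧸ v.asIdeal)).Prime ∧ ringChar (𝓞 K ⧸ v.asIdeal) ∣ n ∧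
      ringChar (𝓞 K ⧸ v.asIdeal) - 1 ∣ 2 * Module.finrank ℚ K := by
  have hD0 : D ≠ 0 := by rintro rfl; exact hD (zero_mem _)
  have hinj : Function.Injective (algebraMap (𝓞 K) K) := RingOfIntegers.coe_injective
  have hlm0 : l * m ≠ 0 := by
    rw [hdet]
    simpa using hD0
  have hl : l ≠ 0 := left_ne_zero_of_mul hlm0
  have hm : m ≠ 0 := right_ne_zero_of_mul hlm0
  obtain ⟨a, ha⟩ : ∃ a, a = l / m := ⟨_, rfl⟩
  have hla : l = a * m := by rw [ha]; field_simp
  have ha1 : a ≠ 1 := by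
    rintro rfl; apply hlm; rw [hla, one_mul]
  have han : a ^ n = 1 := by
    rw [ha, div_pow, hpow, div_self (pow_ne_zero _ hm)]
  have hqpos : 0 < orderOf a := orderOf_pos_iff.mpr (isOfFinOrder_iff_pow_eq_one.mpr ⟨n, hn, han⟩)
  have hqn : orderOf a ∣ n := orderOf_dvd_of_pow_eq_one han
  have hprim : IsPrimitiveRoot a (orderOf a) := IsPrimitiveRoot.orderOf a
  obtain ⟨q, hq⟩ : ∃ q, q = orderOf a := ⟨_, rfl⟩
  rw [← hq] at hqpos hqn hprim
  have haq : a ^ q = 1 := hprim.pow_eq_one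
  have hIntg : IsIntegral ℤ a := hprim.isIntegral hqpos
  obtain ⟨β, hβ⟩ : ∃ β, β = - ∑ i ∈ Finset.range q, ∑ j ∈ Finset.range i, a ^ j := ⟨_, rfl⟩
  have hβint : IsIntegral ℤ β := by
    rw [hβ]
    exact (IsIntegral.sum _ fun i _ => IsIntegral.sum _ fun j _ => hIntg.pow j).neg
  have hqβ : (q : AlgebraicClosure K) = β * (a - 1) := by
    have h0 : ∑ i ∈ Finset.range q, a ^ i = 0 := by
      have := geom_sum_mul a q
      rw [haq, sub_self] at this
      exact (mul_eq_zero.mp this).resolve_right (sub_ne_zero.mpr ha1)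
    rw [hβ, neg_mul, Finset.sum_mul]
    simp_rw [geom_sum_mul]
    rw [Finset.sum_sub_distrib, h0]
    simp
  have key : (q : AlgebraicClosure K) ^ 2 * (l * m) = ((l + m) ^ 2 - 4 * (l * m)) * (a * β ^ 2) := by
    rw [hqβ, hla]; ring
  have hdisc0 : (l + m) ^ 2 - 4 * (l * m) ≠ 0 := by
    have : (l + m) ^ 2 - 4 * (l * m) = (l - m) ^ 2 := by ring
    rw [this]
    exact pow_ne_zero _ (sub_ne_zero.mpr hlm)
  have hγint : IsIntegral ℤ (a * β ^ 2) := hIntg.mul (hβint.pow 2)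
  obtain ⟨b, hb⟩ : ∃ b : 𝓞 K, algebraMap K (AlgebraicClosure K) (algebraMap (𝓞 K) K b) = a * β ^ 2 := by
    have hx : algebraMap K (AlgebraicClosure K) ((q : K) ^ 2 * (algebraMap (𝓞 K) K D) /
        ((algebraMap (𝓞 K) K T) ^ 2 - 4 * algebraMap (𝓞 K) K D)) = a * β ^ 2 := by
      simp only [map_div₀, map_mul, map_sub, map_pow, map_natCast, map_ofNat]
      rw [← htr, ← hdet, key, mul_div_cancel_left₀ _ hdisc0]
    have hxi : IsIntegral ℤ ((q : K) ^ 2 * (algebraMap (𝓞 K) K D) /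
        ((algebraMap (𝓞 K) K T) ^ 2 - 4 * algebraMap (𝓞 K) K D)) := by
      rw [← isIntegral_algebraMap_iff (algebraMap K (AlgebraicClosure K)).injective, hx]
      exact hγint
    exact ⟨⟨_, hxi⟩, hx⟩
  have hqv : (q : 𝓞 K) ∈ v.asIdeal := by
    have e : (q : 𝓞 K) ^ 2 * D = (T ^ 2 - 4 * D) * b := by
      apply hinj
      apply (algebraMap K (AlgebraicClosure K)).injective
      simp only [map_mul, map_sub, map_pow, map_natCast, map_ofNat]
      rw [← htr, ← hdet, hb, key]
    have h2 : (q : 𝓞 K) ^ 2 * D ∈ v.asIdeal := by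
      rw [e]; exact Ideal.mul_mem_right _ _ hdisc
    have h3 := (v.isPrime.mem_or_mem h2).resolve_right hD
    exact v.isPrime.mem_of_pow_mem _ h3
  have hpq : ringChar (𝓞 K ⧸ v.asIdeal) ∣ q := by
    rw [← ringChar.spec]
    have := Ideal.Quotient.eq_zero_iff_mem.mpr hqv
    simpa using this
  have hpp : (ringChar (𝓞 K ⧸ v.asIdeal)).Prime := by
    have := v.isPrime
    refine (CharP.char_is_prime_or_zero (𝓞 K ⧸ v.asIdeal) _).resolve_right fun h => ?_
    rw [h, zero_dvd_iff] at hpq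
    omega
  refine ⟨hpp, hpq.trans hqn, ?_⟩
  have h1 : ringChar (𝓞 K ⧸ v.asIdeal) - 1 ∣ q.totient := by
    rw [← Nat.totient_prime hpp]; exact Nat.totient_dvd_of_dvd hpq
  have haK : IsIntegral K a := hIntg.tower_top
  have h2 : q.totient ∣ Module.finrank ℚ K * (minpoly K a).natDegree := by
    rw [← IntermediateField.adjoin.finrank haK, Module.finrank_mul_finrank]
    have : FiniteDimensional K (IntermediateField.adjoin K {a}) :=
      IntermediateField.adjoin.finiteDimensional haK
    have : FiniteDimensional ℚ (IntermediateField.adjoin K {a}) := FiniteDimensional.trans ℚ K _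
    have hgi : IsIntegral ℚ (IntermediateField.AdjoinSimple.gen K a) := IsIntegral.of_finite _ _
    have h3 := minpoly.degree_dvd hgi
    have h4 : minpoly ℚ (IntermediateField.AdjoinSimple.gen K a) = minpoly ℚ a := by
      rw [← minpoly.algebraMap_eq (B' := AlgebraicClosure K)
        (algebraMap (IntermediateField.adjoin K {a}) _).injective]
      simp
    rw [h4, ← Polynomial.cyclotomic_eq_minpoly_rat hprim hqpos,
      Polynomial.natDegree_cyclotomic] at h3
    exact h3
  have h5 : (minpoly K a).natDegree ≤ 2 := by
    obtain ⟨t, ht⟩ : ∃ t, t = algebraMap (𝓞 K) K T := ⟨_, rfl⟩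
    obtain ⟨δ, hδ⟩ : ∃ δ, δ = algebraMap (𝓞 K) K D := ⟨_, rfl⟩
    have hδ0 : δ ≠ 0 := by rw [hδ]; simpa using hD0
    let P : Polynomial K := Polynomial.C δ * Polynomial.X ^ 2 +
      Polynomial.C (-(t ^ 2 - 2 * δ)) * Polynomial.X + Polynomial.C δ
    have hP : P.natDegree = 2 := Polynomial.natDegree_quadratic hδ0
    have hP0 : P ≠ 0 := by
      intro h; rw [h] at hP; simp at hP
    have hr : Polynomial.aeval a P = 0 := by
      simp only [P, map_add, map_mul, map_pow, Polynomial.aeval_C, Polynomial.aeval_X, map_neg,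
        map_sub, map_ofNat]
      rw [ht, hδ, ← htr, ← hdet, hla]
      ring
    rw [← hP]
    exact Polynomial.natDegree_le_of_dvd (minpoly.dvd K a hr) hP0
  have h6 : 0 < (minpoly K a).natDegree := minpoly.natDegree_pos haK
  refine (h1.trans h2).trans ?_
  rw [mul_comm]
  apply Nat.mul_dvd_mul_right
  interval_cases (minpoly K a).natDegree <;> norm_num
lemma conj_poly {K : Type*} [Field K] {d : ℕ} {Φ A' : Fin 2 → MvPolynomial (Fin 2) K}
    (hhom : ∀ i, (Φ i).IsHomogeneous d) (c u : Kˣ) (hA : ∀ i, A' i = (c : K) • Φ i)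
    (M : GL (Fin 2) K) (hM : MatConj Φ Φ M) (N : Matrix (Fin 2) (Fin 2) K)
    (hN : ∀ i j, N i j = (u : K) * (M : Matrix (Fin 2) (Fin 2) K) i j) :
    ∃ γ : K, γ ≠ 0 ∧ ∀ i, bind₁ A' (linForms N i) = C γ * bind₁ (linForms N) (A' i) := by
  obtain ⟨c0, h⟩ := hM
  refine ⟨(u : K) * c0 / (u : K) ^ d, by simp, fun i => ?_⟩
  have hi := h i
  have hlin : linForms N = (C (u : K) : MvPolynomial (Fin 2) K) • linForms (M : Matrix (Fin 2) (Fin 2) K) := by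
    ext1 i
    simp only [linForms, hN, Pi.smul_apply, smul_eq_mul, C_mul]
    ring
  have e1 : bind₁ A' (linForms N i) =
      C (u : K) * (C (c : K) * bind₁ Φ (linForms (M : Matrix (Fin 2) (Fin 2) K) i)) := by
    rw [hlin]
    simp only [linForms, Pi.smul_apply, smul_eq_mul, map_mul, map_add, bind₁_C_right,
      bind₁_X_right, hA, MvPolynomial.smul_eq_C_mul]
    ring
  have e2 : bind₁ (linForms N) (A' i) =
      C (c : K) * (C (u : K) ^ d * bind₁ (linForms (M : Matrix (Fin 2) (Fin 2) K)) (Φ i)) := by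
    rw [hlin, hA, MvPolynomial.smul_eq_C_mul, map_mul, bind₁_C_right]
    congr 1
    exact scale_form (hhom i) _ _
  rw [e1, e2, hi, ← C_pow]
  have : (C ((u : K) * c0 / (u : K) ^ d) : MvPolynomial (Fin 2) K) * C ((u : K) ^ d) =
      C (u : K) * C (c0 : K) := by
    rw [← C_mul, ← C_mul, div_mul_cancel₀ _ (by simp)]
  linear_combination - (C (c : K) * bind₁ (linForms (M : Matrix (Fin 2) (Fin 2) K)) (Φ i)) * this

lemma conj_ev {K L : Type*} [CommRing K] [CommRing L] [Algebra K L]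
    {A' : Fin 2 → MvPolynomial (Fin 2) K} {N : Matrix (Fin 2) (Fin 2) K} {γ : K}
    (h : ∀ i, bind₁ A' (linForms N i) = C γ * bind₁ (linForms N) (A' i)) (x : Fin 2 → L) :
    (N.map (algebraMap K L)).mulVec (ev A' x) =
      algebraMap K L γ • ev A' ((N.map (algebraMap K L)).mulVec x) := by
  ext i
  have hi := congrArg (aeval x) (h i)
  rw [map_mul, aeval_bind₁, aeval_bind₁, aeval_C] at hi
  have e : (fun j => aeval x (linForms N j)) = (N.map (algebraMap K L)).mulVec x := by
    ext j
    simp [linForms, Matrix.mulVec, dotProduct, Fin.sum_univ_two]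
  rw [e] at hi
  rw [Pi.smul_apply, smul_eq_mul]
  refine Eq.trans ?_ hi
  simp [linForms, Matrix.mulVec, dotProduct, Fin.sum_univ_two, ev]

lemma conj_int {R K : Type*} [CommRing R] [Field K] [Algebra R K]
    {A : Fin 2 → MvPolynomial (Fin 2) R} {N : Matrix (Fin 2) (Fin 2) R} {γ : K}
    (h : ∀ i, bind₁ (fun j => MvPolynomial.map (algebraMap R K) (A j))
        (linForms (N.map (algebraMap R K)) i) =
      C γ * bind₁ (linForms (N.map (algebraMap R K))) (MvPolynomial.map (algebraMap R K) (A i)))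
    (x : Fin 2 → R) (i : Fin 2) :
    algebraMap R K (N.mulVec (ev A x) i) = γ * algebraMap R K (ev A (N.mulVec x) i) := by
  have evm : ∀ x : Fin 2 → R, ev (fun j => MvPolynomial.map (algebraMap R K) (A j))
      (algebraMap R K ∘ x) = algebraMap R K ∘ ev A x := by
    intro x; ext j
    simp only [ev, Function.comp_apply]
    rw [aeval_map_algebraMap, ← aeval_algebraMap_apply]
  have mv : ∀ x : Fin 2 → R, (N.map (algebraMap R K)).mulVec (algebraMap R K ∘ x) =
      algebraMap R K ∘ (N.mulVec x) := by
    intro x; ext j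
    fin_cases j <;> simp [Matrix.mulVec, dotProduct, Fin.sum_univ_two]
  have := congrFun (conj_ev (L := K) h (algebraMap R K ∘ x)) i
  simp only [Algebra.algebraMap_self, RingHom.id_apply, RingHom.coe_id, Matrix.map_id] at this
  rw [evm, mv, mv, evm] at this
  exact this

section GR
variable {R K : Type*} [CommRing R] [IsDedekindDomain R] [Field K] [Algebra R K]
  [IsFractionRing R K]

lemma good_det (v : HeightOneSpectrum R) {A : Fin 2 → MvPolynomial (Fin 2) R} {d : ℕ}
    (hd : 2 ≤ d) (hA : ∀ i, (A i).IsHomogeneous d)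
    (prim : ∀ x : Fin 2 → R, (∃ i, x i ∉ v.asIdeal) → ∃ i, ev A x i ∉ v.asIdeal)
    (N : Matrix (Fin 2) (Fin 2) R) (γ : K)
    (h : ∀ x i, algebraMap R K (N.mulVec (ev A x) i) = γ * algebraMap R K (ev A (N.mulVec x) i))
    (hdet : N.det ≠ 0) (hprim : ∃ i j, N i j ∉ v.asIdeal) : N.det ∉ v.asIdeal := by
  have one : ∀ r : R, r ∉ v.asIdeal → v.valuation K (algebraMap R K r) = 1 := fun r hr =>
    (v.valuation_eq_one_iff_notMem).mpr hr
  have hγ : v.valuation K γ ≤ 1 := by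
    obtain ⟨i, j, hij⟩ := hprim
    obtain ⟨k, hk⟩ := prim (N.mulVec (Pi.single j 1)) ⟨i, by simpa using hij⟩
    have := congrArg (v.valuation K) (h (Pi.single j 1) k)
    rw [map_mul, one _ hk, mul_one] at this
    rw [← this]
    exact v.valuation_le_one _
  obtain ⟨j, k, hjk⟩ : ∃ j k, N.adjugate k j ∉ v.asIdeal := by
    obtain ⟨i, j, hij⟩ := hprim
    rw [Matrix.adjugate_fin_two]
    fin_cases i <;> fin_cases j
    · exact ⟨1, 1, by simpa using hij⟩
    · exact ⟨1, 0, by simpa using hij⟩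
    · exact ⟨0, 1, by simpa using hij⟩
    · exact ⟨0, 0, by simpa using hij⟩
  obtain ⟨x, hx⟩ : ∃ x : Fin 2 → R, x = Pi.single j 1 := ⟨_, rfl⟩
  obtain ⟨i, hi⟩ := prim (N.adjugate.mulVec x) ⟨k, by rw [hx]; simpa using hjk⟩
  have e1 : N.mulVec (N.adjugate.mulVec x) = N.det • x := by
    rw [Matrix.mulVec_mulVec, Matrix.mul_adjugate, Matrix.smul_mulVec, Matrix.one_mulVec]
  have h2 := h (N.adjugate.mulVec x)
  rw [e1, ev_smul hA] at h2
  have e2 : algebraMap R K (N.det * ev A (N.adjugate.mulVec x) i) =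
      γ * algebraMap R K (N.det ^ d * (N.adjugate.mulVec (ev A x)) i) := by
    have e3 : N.det * ev A (N.adjugate.mulVec x) i =
        (N.adjugate.mulVec (N.mulVec (ev A (N.adjugate.mulVec x)))) i := by
      rw [Matrix.mulVec_mulVec, Matrix.adjugate_mul, Matrix.smul_mulVec, Matrix.one_mulVec]
      rfl
    rw [e3]
    have h20 := h2 0
    have h21 := h2 1
    simp only [Pi.smul_apply, smul_eq_mul] at h20 h21
    generalize N.mulVec (ev A (N.adjugate.mulVec x)) = z at h20 h21 ⊢
    simp only [Matrix.mulVec, dotProduct, Fin.sum_univ_two, map_add, map_mul] at h20 h21 ⊢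
    rw [h20, h21]
    ring
  have e4 := congrArg (v.valuation K) e2
  rw [map_mul, map_mul, map_mul, map_mul, map_mul, one _ hi, map_pow, map_pow, mul_one] at e4
  intro hmem
  have hlt : v.valuation K (algebraMap R K N.det) < 1 := (v.valuation_lt_one_iff_mem _).mpr hmem
  have hpos : 0 < v.valuation K (algebraMap R K N.det) := by
    rw [zero_lt_iff, Valuation.ne_zero_iff]
    simpa using hdet
  have h5 : v.valuation K (algebraMap R K N.det) ≤ v.valuation K (algebraMap R K N.det) ^ d := by
    conv_lhs => rw [e4]
    calc _ ≤ 1 * (v.valuation K (algebraMap R K N.det) ^ d * 1) := by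
          gcongr
          exact v.valuation_le_one _
      _ = _ := by simp
  have h6 : v.valuation K (algebraMap R K N.det) ^ d < v.valuation K (algebraMap R K N.det) :=
    pow_lt_self_of_lt_one₀ hpos hlt (by omega)
  exact absurd h5 (not_le.mpr h6)

lemma prim_mul (v : HeightOneSpectrum R) {N : Matrix (Fin 2) (Fin 2) R}
    (hdet : N.det ∉ v.asIdeal) (z : Fin 2 → R) (hz : ∃ i, z i ∉ v.asIdeal) :
    ∃ i, N.mulVec z i ∉ v.asIdeal := by
  by_contra! hc
  obtain ⟨i, hi⟩ := hz
  have e3 : N.det * z i = (N.adjugate.mulVec (N.mulVec z)) i := by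
    rw [Matrix.mulVec_mulVec, Matrix.adjugate_mul, Matrix.smul_mulVec, Matrix.one_mulVec]
    rfl
  have : N.det * z i ∈ v.asIdeal := by
    rw [e3]
    generalize N.mulVec z = y at hc ⊢
    simp only [Matrix.mulVec, dotProduct]
    exact Ideal.sum_mem _ fun j _ => Ideal.mul_mem_left _ _ (hc j)
  exact (v.isPrime.mem_or_mem this).elim hdet hi

lemma good_gamma (v : HeightOneSpectrum R) {A : Fin 2 → MvPolynomial (Fin 2) R}
    (prim : ∀ x : Fin 2 → R, (∃ i, x i ∉ v.asIdeal) → ∃ i, ev A x i ∉ v.asIdeal)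
    (N : Matrix (Fin 2) (Fin 2) R) (γ : K)
    (h : ∀ x i, algebraMap R K (N.mulVec (ev A x) i) = γ * algebraMap R K (ev A (N.mulVec x) i))
    (hdet : N.det ∉ v.asIdeal) : v.valuation K γ = 1 := by
  have one : ∀ r : R, r ∉ v.asIdeal → v.valuation K (algebraMap R K r) = 1 := fun r hr =>
    (v.valuation_eq_one_iff_notMem).mpr hr
  obtain ⟨x, hx⟩ : ∃ x : Fin 2 → R, x = Pi.single 0 1 := ⟨_, rfl⟩
  have hxp : ∃ i, x i ∉ v.asIdeal := by
    refine ⟨0, ?_⟩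
    rw [hx]
    simpa using (Ideal.ne_top_iff_one _).mp v.isPrime.ne_top
  obtain ⟨i, hi⟩ := prim _ (prim_mul v hdet x hxp)
  obtain ⟨j, hj⟩ := prim_mul v hdet _ (prim x hxp)
  have hI := congrArg (v.valuation K) (h x i)
  have hJ := congrArg (v.valuation K) (h x j)
  rw [map_mul, one _ hi, mul_one] at hI
  rw [map_mul, one _ hj] at hJ
  have h1 : v.valuation K γ ≤ 1 := by rw [← hI]; exact v.valuation_le_one _
  refine le_antisymm h1 ?_
  rw [hJ]
  exact mul_le_of_le_one_right' (v.valuation_le_one _)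

lemma unit_frac (v : HeightOneSpectrum R) (γ : K) (h : v.valuation K γ = 1) :
    ∃ a b : R, a ∉ v.asIdeal ∧ b ∉ v.asIdeal ∧ γ * algebraMap R K b = algebraMap R K a := by
  obtain ⟨a, b, hab⟩ := v.exists_primeCompl_mul_eq_of_integer γ h.le
  refine ⟨a, b, ?_, b.2, hab⟩
  rw [← v.valuation_eq_one_iff_notMem (K := K), ← hab, map_mul, h, one_mul,
    v.valuation_eq_one_iff_notMem]
  exact b.2

lemma unit_mod (v : HeightOneSpectrum R) (b : R) (hb : b ∉ v.asIdeal) :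
    IsUnit (Ideal.Quotient.mk v.asIdeal b) := by
  have := v.isMaximal
  obtain ⟨c, hc⟩ := Ideal.Quotient.exists_inv (I := v.asIdeal)
    (a := Ideal.Quotient.mk v.asIdeal b) (by rwa [Ne, Ideal.Quotient.eq_zero_iff_mem])
  exact IsUnit.of_mul_eq_one _ hc

lemma matconj_red (v : HeightOneSpectrum R) {A : Fin 2 → MvPolynomial (Fin 2) R}
    {N : Matrix (Fin 2) (Fin 2) R} {γ : K}
    (h : ∀ i, bind₁ (fun j => MvPolynomial.map (algebraMap R K) (A j))
        (linForms (N.map (algebraMap R K)) i) =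
      C γ * bind₁ (linForms (N.map (algebraMap R K))) (MvPolynomial.map (algebraMap R K) (A i)))
    (hγ : v.valuation K γ = 1) (N' : GL (Fin 2) (R ⧸ v.asIdeal))
    (hN' : (N' : Matrix (Fin 2) (Fin 2) (R ⧸ v.asIdeal)) = N.map (Ideal.Quotient.mk v.asIdeal)) :
    MatConj (fun i => MvPolynomial.map (Ideal.Quotient.mk v.asIdeal) (A i))
      (fun i => MvPolynomial.map (Ideal.Quotient.mk v.asIdeal) (A i)) N' := by
  obtain ⟨a, b, ha, hb, hab⟩ := unit_frac v γ hγ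
  have key : ∀ i, C b * bind₁ A (linForms N i) = C a * bind₁ (linForms N) (A i) := by
    intro i
    apply MvPolynomial.map_injective (algebraMap R K) (IsFractionRing.injective R K)
    have hi := h i
    rw [map_mul, map_mul, map_bind₁, map_bind₁, map_C, map_C, ← hab, C_mul]
    have e : (fun i => MvPolynomial.map (algebraMap R K) (linForms N i)) =
        linForms (N.map (algebraMap R K)) := by ext1 j; simp [linForms]
    have e' : MvPolynomial.map (algebraMap R K) (linForms N i) =
        linForms (N.map (algebraMap R K)) i := congrFun e i
    rw [e, e', hi]
    ring
  obtain ⟨ua, hua⟩ := unit_mod v a ha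
  obtain ⟨ub, hub⟩ := unit_mod v b hb
  refine ⟨ub⁻¹ * ua, fun i => ?_⟩
  have hi := congrArg (MvPolynomial.map (Ideal.Quotient.mk v.asIdeal)) (key i)
  rw [map_mul, map_mul, map_bind₁, map_bind₁, map_C, map_C, ← hua, ← hub] at hi
  have e : (fun i => MvPolynomial.map (Ideal.Quotient.mk v.asIdeal) (linForms N i)) =
      linForms (N' : Matrix (Fin 2) (Fin 2) (R ⧸ v.asIdeal)) := by
    ext1 j; rw [hN']; simp [linForms]
  have e' : MvPolynomial.map (Ideal.Quotient.mk v.asIdeal) (linForms N i) =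
      linForms (N' : Matrix (Fin 2) (Fin 2) (R ⧸ v.asIdeal)) i := congrFun e i
  rw [e, e'] at hi
  have hub1 : (C ((ub⁻¹ : (R ⧸ v.asIdeal)ˣ) : R ⧸ v.asIdeal) : MvPolynomial (Fin 2) (R ⧸ v.asIdeal)) *
      C (ub : R ⧸ v.asIdeal) = 1 := by
    rw [← C_mul]; simp
  rw [Units.val_mul, C_mul, mul_assoc, ← hi, ← mul_assoc, hub1, one_mul]

end GR
lemma pgl_eq {R : Type*} [CommRing R] (M M' : GL (Fin 2) R) :
    PGL2.mk M = PGL2.mk M' ↔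
      ∃ t : R, (M' : Matrix (Fin 2) (Fin 2) R) = t • (M : Matrix (Fin 2) (Fin 2) R) := by
  unfold PGL2.mk
  rw [QuotientGroup.eq, Matrix.GeneralLinearGroup.mem_center_iff_val_mem_range_scalar]
  constructor
  · rintro ⟨t, ht⟩
    refine ⟨t, ?_⟩
    have : (M' : Matrix (Fin 2) (Fin 2) R) = (M * (M⁻¹ * M') : GL (Fin 2) R) := by
      rw [mul_inv_cancel_left]
    rw [this, Units.val_mul, ← ht]
    ext i j
    simp [mul_comm]
  · rintro ⟨t, ht⟩
    refine ⟨t, ?_⟩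
    rw [Units.val_mul, ht, mul_smul_comm, ← Units.val_mul, inv_mul_cancel, Units.val_one]
    exact (Matrix.smul_one_eq_diagonal t).symm

/-- `N` is an integral matrix representing `s`, invertible modulo `v`. -/
def IntRep {R K : Type*} [CommRing R] [IsDedekindDomain R] [Field K] [Algebra R K]
    (v : HeightOneSpectrum R) (s : PGL2 K) (N : Matrix (Fin 2) (Fin 2) R) : Prop :=
  (∃ (M : GL (Fin 2) K) (u : Kˣ), PGL2.mk M = s ∧
    (∀ i j, algebraMap R K (N i j) = (u : K) * (M : Matrix (Fin 2) (Fin 2) K) i j)) ∧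
  N.det ∉ v.asIdeal

section GR2
variable {R K : Type*} [CommRing R] [IsDedekindDomain R] [Field K] [Algebra R K]
  [IsFractionRing R K]

lemma rep_prop (v : HeightOneSpectrum R) {s : PGL2 K} {N1 N2 : Matrix (Fin 2) (Fin 2) R}
    (h1 : IntRep v s N1) (h2 : IntRep v s N2) :
    ∃ t : R ⧸ v.asIdeal, N2.map (Ideal.Quotient.mk v.asIdeal) =
      t • N1.map (Ideal.Quotient.mk v.asIdeal) := by
  obtain ⟨⟨M1, u1, hM1, hN1⟩, hd1⟩ := h1
  obtain ⟨⟨M2, u2, hM2, hN2⟩, hd2⟩ := h2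
  obtain ⟨t0, ht0⟩ := (pgl_eq M1 M2).mp (hM1.trans hM2.symm)
  obtain ⟨t, ht⟩ : ∃ t : K, ∀ i j, algebraMap R K (N2 i j) = t * algebraMap R K (N1 i j) := by
    refine ⟨u2 * t0 * (u1 : K)⁻¹, fun i j => ?_⟩
    rw [hN1, hN2, ht0, Matrix.smul_apply, smul_eq_mul]
    field_simp
  have hdt : algebraMap R K N2.det = t ^ 2 * algebraMap R K N1.det := by
    rw [Matrix.det_fin_two, Matrix.det_fin_two]
    simp only [map_sub, map_mul, ht]
    ring
  have hv := congrArg (v.valuation K) hdt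
  rw [map_mul, map_pow, v.valuation_eq_one_iff_notMem.mpr hd1,
    v.valuation_eq_one_iff_notMem.mpr hd2, mul_one] at hv
  have hvt : v.valuation K t = 1 := by
    exact (pow_eq_one_iff.mp hv.symm).resolve_right (by norm_num)
  obtain ⟨a, b, ha, hb, hab⟩ := unit_frac v t hvt
  have key : ∀ i j, b * N2 i j = a * N1 i j := by
    intro i j
    apply IsFractionRing.injective R K
    rw [map_mul, map_mul, ht, ← hab]
    ring
  obtain ⟨ub, hub⟩ := unit_mod v b hb
  refine ⟨((ub⁻¹ : (R ⧸ v.asIdeal)ˣ) : R ⧸ v.asIdeal) * Ideal.Quotient.mk v.asIdeal a, ?_⟩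
  ext i j
  have := congrArg (Ideal.Quotient.mk v.asIdeal) (key i j)
  rw [map_mul, map_mul, ← hub] at this
  rw [Matrix.map_apply, Matrix.smul_apply, Matrix.map_apply, smul_eq_mul, mul_assoc, ← this,
    Units.inv_mul_cancel_left]

lemma rep_mul (v : HeightOneSpectrum R) {s t : PGL2 K} {N1 N2 : Matrix (Fin 2) (Fin 2) R}
    (h1 : IntRep v s N1) (h2 : IntRep v t N2) : IntRep v (s * t) (N1 * N2) := by
  obtain ⟨⟨M1, u1, hM1, hN1⟩, hd1⟩ := h1
  obtain ⟨⟨M2, u2, hM2, hN2⟩, hd2⟩ := h2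
  refine ⟨⟨M1 * M2, u1 * u2, ?_, fun i j => ?_⟩, ?_⟩
  · rw [← hM1, ← hM2]; rfl
  · rw [Units.val_mul, Units.val_mul, Matrix.mul_apply, Matrix.mul_apply, Fin.sum_univ_two,
      Fin.sum_univ_two, map_add, map_mul, map_mul, hN1, hN1, hN2, hN2]
    ring
  · rw [Matrix.det_mul]
    exact fun h => (v.isPrime.mem_or_mem h).elim hd1 hd2

lemma rep_gl (v : HeightOneSpectrum R) {N : Matrix (Fin 2) (Fin 2) R} (hd : N.det ∉ v.asIdeal) :
    ∃ N' : GL (Fin 2) (R ⧸ v.asIdeal),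
      (N' : Matrix (Fin 2) (Fin 2) (R ⧸ v.asIdeal)) = N.map (Ideal.Quotient.mk v.asIdeal) := by
  have : IsUnit (N.map (Ideal.Quotient.mk v.asIdeal)) := by
    rw [Matrix.isUnit_iff_isUnit_det]
    have := unit_mod v _ hd
    rwa [RingHom.map_det] at this
  exact this

lemma red_exists (v : HeightOneSpectrum R) : ∃ red : PGL2 K → PGL2 (R ⧸ v.asIdeal),
    ∀ s N, IntRep v s N → ∀ N' : GL (Fin 2) (R ⧸ v.asIdeal),
      (N' : Matrix (Fin 2) (Fin 2) (R ⧸ v.asIdeal)) = N.map (Ideal.Quotient.mk v.asIdeal) →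
      red s = PGL2.mk N' := by
  have : ∀ s : PGL2 K, ∃ r : PGL2 (R ⧸ v.asIdeal), ∀ N, IntRep v s N →
      ∀ N' : GL (Fin 2) (R ⧸ v.asIdeal),
      (N' : Matrix (Fin 2) (Fin 2) (R ⧸ v.asIdeal)) = N.map (Ideal.Quotient.mk v.asIdeal) →
      r = PGL2.mk N' := by
    intro s
    by_cases h : ∃ N0, IntRep v s N0
    · obtain ⟨N0, h0⟩ := h
      obtain ⟨N0', h0'⟩ := rep_gl v h0.2
      refine ⟨PGL2.mk N0', fun N hN N' hN' => ?_⟩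
      rw [pgl_eq, h0', hN']
      exact rep_prop v h0 hN
    · exact ⟨1, fun N hN => absurd ⟨N, hN⟩ h⟩
  choose red hred using this
  exact ⟨red, hred⟩

/-- Any matrix can be scaled to be integral and primitive at `v`. -/
lemma exists_prim (v : HeightOneSpectrum R) (M : GL (Fin 2) K) :
    ∃ (N : Matrix (Fin 2) (Fin 2) R) (u : Kˣ),
      (∀ i j, algebraMap R K (N i j) = (u : K) * (M : Matrix (Fin 2) (Fin 2) K) i j) ∧
      ∃ i j, N i j ∉ v.asIdeal := by
  obtain ⟨⟨i0, j0⟩, hmax⟩ := Finite.exists_max (fun q : Fin 2 × Fin 2 =>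
    v.valuation K ((M : Matrix (Fin 2) (Fin 2) K) q.1 q.2))
  obtain ⟨m0, hm0⟩ : ∃ m0, m0 = (M : Matrix (Fin 2) (Fin 2) K) i0 j0 := ⟨_, rfl⟩
  have hne : m0 ≠ 0 := by
    intro h
    have hz : (M : Matrix (Fin 2) (Fin 2) K) = 0 := by
      ext i j
      have := hmax (i, j)
      simp only at this
      rw [← hm0, h, map_zero, le_zero_iff, map_eq_zero] at this
      exact this
    have := M.ne_zero
    exact this hz
  have hval : ∀ q : Fin 2 × Fin 2,
      v.valuation K ((M : Matrix (Fin 2) (Fin 2) K) q.1 q.2 / m0) ≤ 1 := by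
    intro q
    rw [map_div₀]
    apply div_le_one_of_le₀
    · rw [hm0]; exact hmax q
    · exact zero_le
  choose n b hb using fun q => v.exists_primeCompl_mul_eq_of_integer _ (hval q)
  obtain ⟨B, hB⟩ : ∃ B : v.asIdeal.primeCompl, B = ∏ q, b q := ⟨_, rfl⟩
  have hdvd : ∀ q, ∃ e, B = b q * e := fun q => by
    rw [hB]; exact Finset.dvd_prod_of_mem b (Finset.mem_univ q)
  choose e he using hdvd
  have hB0 : algebraMap R K B ≠ 0 := by
    intro h
    have : (B : R) = 0 := by simpa using h
    apply B.2
    rw [SetLike.mem_coe, this]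
    exact zero_mem _
  refine ⟨fun i j => n (i, j) * e (i, j), Units.mk0 (algebraMap R K B / m0) (div_ne_zero hB0 hne), ?_, i0, j0, ?_⟩
  · intro i j
    have h1 := hb (i, j)
    have h2 := congrArg (fun x : v.asIdeal.primeCompl => algebraMap R K x) (he (i, j))
    simp only [Submonoid.coe_mul, map_mul] at h1 h2
    rw [map_mul, ← h1, Units.val_mk0, h2]
    ring
  · have h1 := hb (i0, j0)
    simp only at h1
    rw [← hm0, div_self hne, one_mul] at h1
    have h3 := IsFractionRing.injective R K h1
    show n (i0, j0) * (e (i0, j0) : R) ∉ v.asIdeal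
    rw [← h3]
    have := B.2
    rw [he (i0, j0)] at this
    exact this

end GR2
lemma prim_of_rel {R : Type*} [CommRing R] [IsDedekindDomain R] (v : HeightOneSpectrum R)
    {A : Fin 2 → MvPolynomial (Fin 2) R} {d : ℕ} (hA : ∀ i, (A i).IsHomogeneous d)
    (hAred : IsRelPrime
      (MvPolynomial.map (Ideal.Quotient.mk v.asIdeal) (A 0))
      (MvPolynomial.map (Ideal.Quotient.mk v.asIdeal) (A 1)))
    (x : Fin 2 → R) (hx : ∃ i, x i ∉ v.asIdeal) : ∃ i, ev A x i ∉ v.asIdeal := by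
  by_contra! hc
  have := v.isMaximal
  letI : Field (R ⧸ v.asIdeal) := Ideal.Quotient.field v.asIdeal
  have key : ∀ i, aeval (fun j => Ideal.Quotient.mk v.asIdeal (x j))
      (MvPolynomial.map (Ideal.Quotient.mk v.asIdeal) (A i)) = 0 := by
    intro i
    have h := Ideal.Quotient.eq_zero_iff_mem.mpr (hc i)
    rw [← h, ev, aeval_eq_eval₂Hom, aeval_eq_eval₂Hom, eval₂Hom_map_hom, map_eval₂Hom]
    rfl
  refine no_common_zero ((hA 0).map _) ((hA 1).map _) hAred
    (fun j => Ideal.Quotient.mk v.asIdeal (x j)) ?_ (key 0) (key 1)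
  intro h
  obtain ⟨i, hi⟩ := hx
  exact hi (Ideal.Quotient.eq_zero_iff_mem.mp (congrFun h i))

lemma adj_ev {K L : Type*} [Field K] [Field L] [Algebra K L]
    {A : Fin 2 → MvPolynomial (Fin 2) K} {d : ℕ} (hA : ∀ i, (A i).IsHomogeneous d)
    (N : Matrix (Fin 2) (Fin 2) L) (g : L) (hg : g ≠ 0) (hdet : N.det ≠ 0)
    (hN : ∀ x, N.mulVec (ev A x) = g • ev A (N.mulVec x)) (y : Fin 2 → L) :
    N.adjugate.mulVec (ev A y) = (N.det / (g * N.det ^ d)) • ev A (N.adjugate.mulVec y) := by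
  have h1 := hN (N.adjugate.mulVec y)
  rw [Matrix.mulVec_mulVec, Matrix.mul_adjugate, Matrix.smul_mulVec, Matrix.one_mulVec,
    ev_smul hA] at h1
  have h2 := congrArg (fun z => N.adjugate.mulVec z) h1
  rw [Matrix.mulVec_mulVec, Matrix.adjugate_mul, Matrix.smul_mulVec, Matrix.one_mulVec,
    Matrix.mulVec_smul, Matrix.mulVec_smul] at h2
  rw [div_eq_inv_mul, mul_smul, h2, smul_smul, smul_smul, mul_assoc, inv_mul_cancel₀, one_smul]
  exact mul_ne_zero hg (pow_ne_zero _ hdet)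

lemma scalar_of_cong {K : Type*} [Field K] [NumberField K] {d : ℕ} (hd : 2 ≤ d)
    (v : HeightOneSpectrum (𝓞 K))
    (hS₀ : ¬ (ringChar (𝓞 K ⧸ v.asIdeal) = 2 ∨
      ((ringChar (𝓞 K ⧸ v.asIdeal)).Prime ∧ Odd (ringChar (𝓞 K ⧸ v.asIdeal)) ∧
        (ringChar (𝓞 K ⧸ v.asIdeal) - 1) / 2 ∣ Module.finrank ℚ K ∧
        ringChar (𝓞 K ⧸ v.asIdeal) ∣ d * (d ^ 2 - 1))))
    {A : Fin 2 → MvPolynomial (Fin 2) K} (hA : ∀ i, (A i).IsHomogeneous d)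
    (hnz : ∀ x : Fin 2 → AlgebraicClosure K, x ≠ 0 → ev A x ≠ 0)
    (N : Matrix (Fin 2) (Fin 2) (𝓞 K)) (c : AlgebraicClosure K)
    (j : 𝓞 K →+* AlgebraicClosure K)
    (hj : j = (algebraMap K (AlgebraicClosure K)).comp (algebraMap (𝓞 K) K))
    (hN : ∀ x, (N.map j).mulVec (ev A x) = c • ev A ((N.map j).mulVec x))
    (hD : N.det ∉ v.asIdeal) (h01 : N 0 1 ∈ v.asIdeal)
    (h00 : N 0 0 - N 1 1 ∈ v.asIdeal) :
    N 0 1 = 0 ∧ N 1 0 = 0 ∧ N 0 0 = N 1 1 := by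
  have hinj : Function.Injective j := by
    rw [hj]
    exact (algebraMap K (AlgebraicClosure K)).injective.comp RingOfIntegers.coe_injective
  by_contra hns
  obtain ⟨T, hT⟩ : ∃ T, T = N 0 0 + N 1 1 := ⟨_, rfl⟩
  obtain ⟨D, hDD⟩ : ∃ D, D = N 0 0 * N 1 1 - N 0 1 * N 1 0 := ⟨_, rfl⟩
  have hD' : D ∉ v.asIdeal := by rwa [hDD, ← Matrix.det_fin_two]
  have hD0 : D ≠ 0 := by rintro h; rw [h] at hD'; exact hD' (zero_mem _)
  obtain ⟨δ, hδ⟩ := IsAlgClosed.exists_pow_nat_eq (j (T ^ 2 - 4 * D)) (n := 2) (by norm_num)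
  simp only [map_sub, map_pow, map_mul, map_ofNat] at hδ
  have htr : (j T + δ) / 2 + (j T - δ) / 2 = j T := by ring
  have hdet : (j T + δ) / 2 * ((j T - δ) / 2) = j D := by linear_combination (-1/4) * hδ
  have hdisc : T ^ 2 - 4 * D ∈ v.asIdeal := by
    have : T ^ 2 - 4 * D = (N 0 0 - N 1 1) * (N 0 0 - N 1 1) + (4 * N 1 0) * N 0 1 := by
      rw [hT, hDD]; ring
    rw [this]
    exact add_mem (Ideal.mul_mem_left _ _ h00) (Ideal.mul_mem_left _ _ h01)
  obtain ⟨hlm, n, hn, hpow⟩ := eig_main hd hA hnz (N.map j) c _ _ hN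
    (htr.trans (by simp [hT])) (hdet.trans (by simp [hDD]))
    (by rw [hdet]; exact (map_ne_zero_iff j hinj).mpr hD0)
    (by
      rintro ⟨h1, h2, h3⟩
      simp only [Matrix.map_apply] at h1 h2 h3
      exact hns ⟨hinj (by rw [h1, map_zero]), hinj (by rw [h2, map_zero]), hinj h3⟩)
  obtain ⟨hp, hpn, hpd⟩ := arith_main v T D _ _ (htr.trans (by rw [hj]; rfl))
    (hdet.trans (by rw [hj]; rfl)) hD' hdisc hlm n (by omega) hpow
  generalize ringChar (𝓞 K ⧸ v.asIdeal) = p at *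
  apply hS₀
  rcases hp.eq_two_or_odd' with h | h
  · exact Or.inl h
  · refine Or.inr ⟨hp, h, ?_, ?_⟩
    · obtain ⟨k, rfl⟩ := h
      rw [show 2 * k + 1 - 1 = 2 * k by omega] at hpd ⊢
      rw [Nat.mul_div_cancel_left _ (by norm_num)]
      exact Nat.dvd_of_mul_dvd_mul_left (by norm_num) hpd
    · have e : d ^ 2 - 1 = (d + 1) * (d - 1) := by
        have := Nat.sq_sub_sq d 1
        simpa using this
      rw [e]
      rcases hn with rfl | rfl | rfl
      · exact (hpn.mul_left _).mul_left _
      · exact hpn.mul_right _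
      · exact (hpn.mul_right _).mul_left _

lemma aut_rep {K : Type*} [Field K] [NumberField K] {d : ℕ} (hd : 2 ≤ d)
    {Φ : Fin 2 → MvPolynomial (Fin 2) K} (hhom : ∀ i, (Φ i).IsHomogeneous d)
    (v : HeightOneSpectrum (𝓞 K)) (c : Kˣ) {A : Fin 2 → MvPolynomial (Fin 2) (𝓞 K)}
    (hA : ∀ i, MvPolynomial.map (algebraMap (𝓞 K) K) (A i) = (c : K) • Φ i)
    (hAhom : ∀ i, (A i).IsHomogeneous d)
    (prim : ∀ x : Fin 2 → 𝓞 K, (∃ i, x i ∉ v.asIdeal) → ∃ i, ev A x i ∉ v.asIdeal)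
    (s : PGL2 K) (hs : s ∈ AutSet Φ) :
    ∃ (N : Matrix (Fin 2) (Fin 2) (𝓞 K)) (γ : K), IntRep v s N ∧ γ ≠ 0 ∧
      ∀ i, bind₁ (fun j => MvPolynomial.map (algebraMap (𝓞 K) K) (A j))
        (linForms (N.map (algebraMap (𝓞 K) K)) i) =
      C γ * bind₁ (linForms (N.map (algebraMap (𝓞 K) K)))
        (MvPolynomial.map (algebraMap (𝓞 K) K) (A i)) := by
  obtain ⟨M, hMs, hM⟩ := hs
  obtain ⟨N, u, hN, hp⟩ := exists_prim v M
  obtain ⟨γ, hγ, h⟩ := conj_poly hhom c u hA M hM (N.map (algebraMap (𝓞 K) K)) hN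
  refine ⟨N, γ, ⟨⟨M, u, hMs, hN⟩, ?_⟩, hγ, h⟩
  refine good_det v hd hAhom prim N γ (fun x i => conj_int h x i) ?_ hp
  intro h0
  have h1 := congrArg (algebraMap (𝓞 K) K) h0
  rw [Matrix.det_fin_two] at h1
  simp only [map_sub, map_mul, hN, map_zero] at h1
  have h2 : (u : K) ^ 2 * (M : Matrix (Fin 2) (Fin 2) K).det = 0 := by
    rw [Matrix.det_fin_two]; linear_combination h1
  have h3 : (M : Matrix (Fin 2) (Fin 2) K).det ≠ 0 :=
    ((Matrix.isUnit_iff_isUnit_det _).mp M.isUnit).ne_zero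
  exact (mul_ne_zero (pow_ne_zero 2 u.ne_zero) h3) h2

lemma inj_core {K : Type*} [Field K] [NumberField K] {d : ℕ} (hd : 2 ≤ d)
    {Φ : Fin 2 → MvPolynomial (Fin 2) K} (hhom : ∀ i, (Φ i).IsHomogeneous d)
    (hrel : IsRelPrime (Φ 0) (Φ 1))
    (v : HeightOneSpectrum (𝓞 K)) (c : Kˣ) {A : Fin 2 → MvPolynomial (Fin 2) (𝓞 K)}
    (hA : ∀ i, MvPolynomial.map (algebraMap (𝓞 K) K) (A i) = (c : K) • Φ i)
    (hAhom : ∀ i, (A i).IsHomogeneous d)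
    (hS₀ : ¬ (ringChar (𝓞 K ⧸ v.asIdeal) = 2 ∨
      ((ringChar (𝓞 K ⧸ v.asIdeal)).Prime ∧ Odd (ringChar (𝓞 K ⧸ v.asIdeal)) ∧
        (ringChar (𝓞 K ⧸ v.asIdeal) - 1) / 2 ∣ Module.finrank ℚ K ∧
        ringChar (𝓞 K ⧸ v.asIdeal) ∣ d * (d ^ 2 - 1))))
    {s t : PGL2 K} {N1 N2 : Matrix (Fin 2) (Fin 2) (𝓞 K)} {γ1 γ2 : K}
    (hR1 : IntRep v s N1) (hR2 : IntRep v t N2) (hγ1 : γ1 ≠ 0)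
    (h1 : ∀ i, bind₁ (fun j => MvPolynomial.map (algebraMap (𝓞 K) K) (A j))
        (linForms (N1.map (algebraMap (𝓞 K) K)) i) =
      C γ1 * bind₁ (linForms (N1.map (algebraMap (𝓞 K) K)))
        (MvPolynomial.map (algebraMap (𝓞 K) K) (A i)))
    (h2 : ∀ i, bind₁ (fun j => MvPolynomial.map (algebraMap (𝓞 K) K) (A j))
        (linForms (N2.map (algebraMap (𝓞 K) K)) i) =
      C γ2 * bind₁ (linForms (N2.map (algebraMap (𝓞 K) K)))
        (MvPolynomial.map (algebraMap (𝓞 K) K) (A i)))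
    (r : 𝓞 K ⧸ v.asIdeal)
    (hr : N2.map (Ideal.Quotient.mk v.asIdeal) = r • N1.map (Ideal.Quotient.mk v.asIdeal)) :
    s = t := by
  obtain ⟨A', hA'⟩ : ∃ A', A' = fun j => MvPolynomial.map (algebraMap (𝓞 K) K) (A j) := ⟨_, rfl⟩
  have hA'hom : ∀ i, (A' i).IsHomogeneous d := fun i => by rw [hA']; exact (hAhom i).map _
  have hnz : ∀ x : Fin 2 → AlgebraicClosure K, x ≠ 0 → ev A' x ≠ 0 := by
    intro x hx h0
    have key : ∀ i, aeval x (Φ i) = 0 := by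
      intro i
      have h := congrFun h0 i
      rw [hA'] at h
      simp only [ev, hA i, map_smul, Pi.zero_apply, smul_eq_zero] at h
      exact h.resolve_left c.ne_zero
    exact no_common_zero (hhom 0) (hhom 1) hrel x hx (key 0) (key 1)
  obtain ⟨j, hj⟩ : ∃ j, j = (algebraMap K (AlgebraicClosure K)).comp (algebraMap (𝓞 K) K) :=
    ⟨_, rfl⟩
  have hmap : ∀ N : Matrix (Fin 2) (Fin 2) (𝓞 K), (N.map (algebraMap (𝓞 K) K)).map
      (algebraMap K (AlgebraicClosure K)) = N.map j := by
    intro N; rw [hj]; ext a b; rfl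
  have hinj : Function.Injective j := by
    rw [hj]
    exact (algebraMap K (AlgebraicClosure K)).injective.comp RingOfIntegers.coe_injective
  have hd1 : N1.det ≠ 0 := by
    intro h; apply hR1.2; rw [h]; exact zero_mem _
  have e1 : ∀ x : Fin 2 → AlgebraicClosure K, (N1.map j).mulVec (ev A' x) =
      algebraMap K (AlgebraicClosure K) γ1 • ev A' ((N1.map j).mulVec x) := by
    intro x; rw [← hmap, hA']; exact conj_ev h1 x
  have e2 : ∀ x : Fin 2 → AlgebraicClosure K, (N2.map j).mulVec (ev A' x) =
      algebraMap K (AlgebraicClosure K) γ2 • ev A' ((N2.map j).mulVec x) := by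
    intro x; rw [← hmap, hA']; exact conj_ev h2 x
  have hdj : (N1.map j).det = j N1.det := (RingHom.map_det j N1).symm
  have hadj : N1.adjugate.map j = (N1.map j).adjugate := RingHom.map_adjugate j N1
  obtain ⟨N, hN⟩ : ∃ N, N = N1.adjugate * N2 := ⟨_, rfl⟩
  obtain ⟨k, hk⟩ : ∃ k : AlgebraicClosure K, ∀ x, (N.map j).mulVec (ev A' x) =
      k • ev A' ((N.map j).mulVec x) := by
    refine ⟨algebraMap K (AlgebraicClosure K) γ2 * ((N1.map j).det /
      (algebraMap K (AlgebraicClosure K) γ1 * (N1.map j).det ^ d)), fun x => ?_⟩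
    rw [hN, Matrix.map_mul, hadj, ← Matrix.mulVec_mulVec, e2, Matrix.mulVec_smul,
      adj_ev hA'hom (N1.map j) _ ?_ ?_ e1, smul_smul, Matrix.mulVec_mulVec]
    · simpa using hγ1
    · rw [hdj]; exact (map_ne_zero_iff j hinj).mpr hd1
  have hNbar : N.map (Ideal.Quotient.mk v.asIdeal) =
      (r * Ideal.Quotient.mk v.asIdeal N1.det) • 1 := by
    have ha : N1.adjugate.map (Ideal.Quotient.mk v.asIdeal) =
      (N1.map (Ideal.Quotient.mk v.asIdeal)).adjugate := RingHom.map_adjugate _ N1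
    have hdd : (N1.map (Ideal.Quotient.mk v.asIdeal)).det =
      Ideal.Quotient.mk v.asIdeal N1.det := (RingHom.map_det _ N1).symm
    rw [hN, Matrix.map_mul, hr, ha, Matrix.mul_smul, Matrix.adjugate_mul, hdd, smul_smul]
  have hDN : N.det ∉ v.asIdeal := by
    rw [hN, Matrix.det_mul, Matrix.adjugate_fin_two, Matrix.det_fin_two_of]
    intro h
    rcases v.isPrime.mem_or_mem h with h | h
    · apply hR1.2
      rw [Matrix.det_fin_two]
      convert h using 1
      ring
    · exact hR2.2 h
  have h01 : N 0 1 ∈ v.asIdeal := by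
    rw [← Ideal.Quotient.eq_zero_iff_mem]
    have := congrFun (congrFun hNbar 0) 1
    simpa using this
  have h00 : N 0 0 - N 1 1 ∈ v.asIdeal := by
    rw [← Ideal.Quotient.eq_zero_iff_mem]
    have a := congrFun (congrFun hNbar 0) 0
    have b := congrFun (congrFun hNbar 1) 1
    rw [Matrix.map_apply] at a b
    rw [map_sub, a, b]
    simp
  obtain ⟨z1, z2, z3⟩ := scalar_of_cong hd v hS₀ hA'hom hnz N k j hj hk hDN h01 h00
  have hsc : N = N 0 0 • 1 := by
    ext a b
    fin_cases a <;> fin_cases b <;> simp [z1, z2, z3]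
  have hrel2 : N1.det • N2 = N 0 0 • N1 := by
    have : N1 * N = N1.det • N2 := by
      rw [hN, ← Matrix.mul_assoc, Matrix.mul_adjugate, Matrix.smul_mul, Matrix.one_mul]
    rw [← this]
    conv_lhs => rw [hsc]
    rw [Matrix.mul_smul, Matrix.mul_one]
  obtain ⟨⟨M1, u1, hM1, hN1⟩, -⟩ := hR1
  obtain ⟨⟨M2, u2, hM2, hN2⟩, -⟩ := hR2
  rw [← hM1, ← hM2, pgl_eq]
  have hdK : algebraMap (𝓞 K) K N1.det ≠ 0 :=
    (map_ne_zero_iff _ RingOfIntegers.coe_injective).mpr hd1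
  refine ⟨(u2 : K)⁻¹ * (algebraMap (𝓞 K) K N1.det)⁻¹ * algebraMap (𝓞 K) K (N 0 0) * u1, ?_⟩
  ext a b
  have h := congrArg (algebraMap (𝓞 K) K) (congrFun (congrFun hrel2 a) b)
  simp only [Matrix.smul_apply, smul_eq_mul, map_mul, hN1, hN2] at h
  rw [Matrix.smul_apply, smul_eq_mul]
  have hu := u2.ne_zero
  field_simp
  linear_combination h

/-- for a number field `K` and `φ` of degree `d ≥ 2`, the reduction map
`Aut_φ(K) → Aut_φ(𝔽_v)` is a well-defined injective group homomorphism at every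
place `v` of good reduction whose residue characteristic is not in the
exceptional set `S₀`. -/
theorem reduction_injective_on_aut
    {K : Type*} [Field K] [NumberField K]
    (d : ℕ) (hd : 2 ≤ d)
    (Φ : Fin 2 → MvPolynomial (Fin 2) K)
    (hhom : ∀ i, (Φ i).IsHomogeneous d)
    (hrel : IsRelPrime (Φ 0) (Φ 1))
    (v : HeightOneSpectrum (𝓞 K))
    -- φ has good reduction at v, with explicit data
    (c : Kˣ) (A : Fin 2 → MvPolynomial (Fin 2) (𝓞 K))
    (hA : ∀ i, MvPolynomial.map (algebraMap (𝓞 K) K) (A i) = (c : K) • Φ i)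
    (hAred : IsRelPrime
      (MvPolynomial.map (Ideal.Quotient.mk v.asIdeal) (A 0))
      (MvPolynomial.map (Ideal.Quotient.mk v.asIdeal) (A 1)))
    -- v does not divide any prime of S₀
    (hS₀ : ¬ (ringChar (𝓞 K ⧸ v.asIdeal) = 2 ∨
      ((ringChar (𝓞 K ⧸ v.asIdeal)).Prime ∧ Odd (ringChar (𝓞 K ⧸ v.asIdeal)) ∧
        (ringChar (𝓞 K ⧸ v.asIdeal) - 1) / 2 ∣ Module.finrank ℚ K ∧
        ringChar (𝓞 K ⧸ v.asIdeal) ∣ d * (d ^ 2 - 1)))) :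
    ∃ red : PGL2 K → PGL2 (𝓞 K ⧸ v.asIdeal),
      -- every element of Aut_φ(K) has good reduction at v
      (∀ s ∈ AutSet Φ, ∃ (M : GL (Fin 2) K)
          (N : Matrix (Fin 2) (Fin 2) (𝓞 K)) (u : Kˣ),
        PGL2.mk M = s ∧
        (∀ i j, algebraMap (𝓞 K) K (N i j) =
          (u : K) * (M : Matrix (Fin 2) (Fin 2) K) i j) ∧
        N.det ∉ v.asIdeal) ∧
      -- red maps Aut_φ(K) into Aut_{φ̃}(𝔽_v)
      (∀ s ∈ AutSet Φ,
        red s ∈ AutSet (fun i => MvPolynomial.map (Ideal.Quotient.mk v.asIdeal) (A i))) ∧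
      -- red is a homomorphism on Aut_φ(K)
      (∀ s ∈ AutSet Φ, ∀ t ∈ AutSet Φ, red (s * t) = red s * red t) ∧
      -- red is given by reduction of matrix entries
      (∀ s ∈ AutSet Φ, ∀ (M : GL (Fin 2) K)
          (N : Matrix (Fin 2) (Fin 2) (𝓞 K)) (u : Kˣ),
        PGL2.mk M = s →
        (∀ i j, algebraMap (𝓞 K) K (N i j) =
          (u : K) * (M : Matrix (Fin 2) (Fin 2) K) i j) →
        N.det ∉ v.asIdeal →
        ∀ N' : GL (Fin 2) (𝓞 K ⧸ v.asIdeal),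
          (N' : Matrix (Fin 2) (Fin 2) (𝓞 K ⧸ v.asIdeal)) =
            N.map (Ideal.Quotient.mk v.asIdeal) →
          red s = PGL2.mk N') ∧
      -- red is injective on Aut_φ(K)
      Set.InjOn red (AutSet Φ) := by
  have hAhom : ∀ i, (A i).IsHomogeneous d := by
    intro i
    apply MvPolynomial.IsHomogeneous.of_map (f := algebraMap (𝓞 K) K) RingOfIntegers.coe_injective
    rw [hA i, smul_eq_C_mul]
    simpa using (isHomogeneous_C (Fin 2) (c : K)).mul (hhom i)
  have prim := prim_of_rel v hAhom hAred
  have rep := aut_rep hd hhom v c hA hAhom prim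
  obtain ⟨red, hred⟩ := red_exists (K := K) v
  refine ⟨red, ?_, ?_, ?_, ?_, ?_⟩
  · intro s hs
    obtain ⟨N, γ, ⟨⟨M, u, hM, hN⟩, hdet⟩, -⟩ := rep s hs
    exact ⟨M, N, u, hM, hN, hdet⟩
  · intro s hs
    obtain ⟨N, γ, hR, -, h⟩ := rep s hs
    obtain ⟨N', hN'⟩ := rep_gl v hR.2
    have hγ := good_gamma v prim N γ (fun x i => conj_int h x i) hR.2
    exact ⟨N', (hred s N hR N' hN').symm, matconj_red v h hγ N' hN'⟩
  · intro s hs t ht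
    obtain ⟨N1, -, hR1, -⟩ := rep s hs
    obtain ⟨N2, -, hR2, -⟩ := rep t ht
    obtain ⟨N1', hN1'⟩ := rep_gl v hR1.2
    obtain ⟨N2', hN2'⟩ := rep_gl v hR2.2
    rw [hred s N1 hR1 N1' hN1', hred t N2 hR2 N2' hN2',
      hred (s * t) (N1 * N2) (rep_mul v hR1 hR2) (N1' * N2')
        (by rw [Units.val_mul, hN1', hN2', Matrix.map_mul])]
    rfl
  · intro s hs M N u hM hN hdet N' hN'
    exact hred s N ⟨⟨M, u, hM, hN⟩, hdet⟩ N' hN'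
  · intro s hs t ht hst
    obtain ⟨N1, γ1, hR1, hγ1, h1⟩ := rep s hs
    obtain ⟨N2, γ2, hR2, hγ2, h2⟩ := rep t ht
    obtain ⟨N1', hN1'⟩ := rep_gl v hR1.2
    obtain ⟨N2', hN2'⟩ := rep_gl v hR2.2
    rw [hred s N1 hR1 N1' hN1', hred t N2 hR2 N2' hN2', pgl_eq, hN1', hN2'] at hst
    obtain ⟨r, hr⟩ := hst
    exact inj_core hd hhom hrel v c hA hAhom hS₀ hR1 hR2 hγ1 h1 h2 r hr
end
end
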